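/- arXiv:1710.04109 — 4 statements merged into one kernel-verified Lean document; each statement's English description precedes it below -/
import Mathlib

section
/- For n = 2 and any real numbers v, v' > 0, for all words w_0, w_1, w_2 with letters in {0,1,2} and all indices i_0, i_1, i_2 ∈ {0,1,2}, sign( det( ρ_v(w_0)(α_{i_0}), ρ_v(w_1)(α_{i_1}), ρ_v(w_2)(α_{i_2}) ) ) = sign( det( ρ_{v'}(w_0)(α_{i_0}), ρ_{v'}(w_1)(α_{i_1}), ρ_{v'}(w_2)(α_{i_2}) ) ), where sign takes values in {−1, 0, 1}. (In other words, the chirotope of the realized root system of type Ã_2 with parameter v is independent of v.) -/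
/-- The NGCM `C(n,v)` of affine type `Ã_n` with parameter `v`. -/
noncomputable def Cmat (n : ℕ) (v : ℝ) : Matrix (Fin (n + 1)) (Fin (n + 1)) ℝ :=
  Matrix.of fun i j =>
    if i = j then 2
    else if (i : ℕ) = 0 ∧ (j : ℕ) = 1 then -v
    else if (i : ℕ) = n ∧ (j : ℕ) = 0 then -v
    else if (i : ℕ) = 1 ∧ (j : ℕ) = 0 then -v⁻¹
    else if (i : ℕ) = 0 ∧ (j : ℕ) = n then -v⁻¹
    else if (i : ℕ) + 1 = (j : ℕ) ∨ (j : ℕ) + 1 = (i : ℕ) then -1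
    else 0

/-- The simple reflection `σ_j : x ↦ x - (∑_i C_{i,j} x_i) α_j` for the NGCM `C(n,v)`. -/
noncomputable def sigmaV (n : ℕ) (v : ℝ) (j : Fin (n + 1)) :
    (Fin (n + 1) → ℝ) → (Fin (n + 1) → ℝ) :=
  fun x => x - (∑ i, Cmat n v i j * x i) • (Pi.single j 1 : Fin (n + 1) → ℝ)

/-- `ρ_v(w) = σ_{j_1} ∘ ⋯ ∘ σ_{j_r}` for a word `w = (j_1, …, j_r)`. -/
noncomputable def rhoV (n : ℕ) (v : ℝ) : List (Fin (n + 1)) → (Fin (n + 1) → ℝ) → (Fin (n + 1) → ℝ)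
  | [] => id
  | j :: w => sigmaV n v j ∘ rhoV n v w

/-- The determinant of the square matrix whose `l`-th column is `γ l`. -/
noncomputable def detCols {n : ℕ} (γ : Fin n → Fin n → ℝ) : ℝ :=
  Matrix.det (Matrix.of fun i l => γ l i)


/-- The `q`-integer `[k] = (1 - q^k) / (1 - q)` at `q = v^2`. -/
noncomputable def qint (v : ℝ) (k : ℤ) : ℝ :=
  if v ^ 2 = 1 then (k : ℝ) else (1 - (v ^ 2) ^ k) / (1 - v ^ 2)

lemma qint_zero (v : ℝ) : qint v 0 = 0 := by
  unfold qint; split_ifs <;> simp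

lemma qint_one (v : ℝ) : qint v 1 = 1 := by
  unfold qint
  split_ifs with h
  · simp
  · have : 1 - v ^ 2 ≠ 0 := fun h' => h (by linarith)
    simp [div_self this]

lemma qint_pow {v : ℝ} (k : ℤ) : 1 - (1 - v ^ 2) * qint v k = (v ^ 2) ^ k := by
  unfold qint
  split_ifs with h
  · simp [h]
  · have : 1 - v ^ 2 ≠ 0 := fun h' => h (by linarith)
    field_simp
    ring

lemma qint_pos_aux {v : ℝ} (hv : 0 < v) (k : ℤ) : 0 < 1 - (1 - v ^ 2) * qint v k := by
  rw [qint_pow]; positivity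

lemma qint_add {v : ℝ} (hv : 0 < v) (a b : ℤ) :
    qint v (a + b) = qint v a + qint v b - (1 - v ^ 2) * qint v a * qint v b := by
  have hq : v ^ 2 ≠ 0 := by positivity
  unfold qint
  split_ifs with h
  · simp [h]
  · have : 1 - v ^ 2 ≠ 0 := fun h' => h (by linarith)
    rw [zpow_add₀ hq]
    field_simp
    ring

lemma qint_sub {v : ℝ} (hv : 0 < v) (a b : ℤ) :
    qint v (a - b) * (1 - (1 - v ^ 2) * qint v b) = qint v a - qint v b := by
  have h := qint_add hv (a - b) b
  rw [sub_add_cancel] at h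
  linear_combination -h

lemma qint_nat_pos {v : ℝ} (hv : 0 < v) (n : ℕ) : 0 < qint v ((n : ℤ) + 1) := by
  induction n with
  | zero => simp [qint_one]
  | succ n ih =>
    rw [qint_add hv, qint_one]
    push_cast
    have : 0 < v ^ 2 * qint v ((n : ℤ) + 1) := by positivity
    nlinarith

lemma qint_pos {v : ℝ} (hv : 0 < v) {k : ℤ} (hk : 0 < k) : 0 < qint v k := by
  obtain ⟨n, rfl⟩ : ∃ n : ℕ, k = (n : ℤ) + 1 := ⟨(k - 1).toNat, by omega⟩
  exact qint_nat_pos hv n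

lemma sign_pos_mul {c x : ℝ} (hc : 0 < c) : Real.sign (c * x) = Real.sign x := by
  rcases lt_trichotomy x 0 with h | h | h
  · rw [Real.sign_of_neg h, Real.sign_of_neg (mul_neg_of_pos_of_neg hc h)]
  · simp [h]
  · rw [Real.sign_of_pos h, Real.sign_of_pos (mul_pos hc h)]

lemma sign_qint {v : ℝ} (hv : 0 < v) (k : ℤ) : Real.sign (qint v k) = Real.sign (k : ℝ) := by
  rcases lt_trichotomy k 0 with h | h | h
  · have h1 := qint_sub hv 0 k
    have h2 : 0 < qint v (0 - k) := qint_pos hv (by omega)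
    have h3 := mul_pos h2 (qint_pos_aux hv k)
    rw [qint_zero] at h1
    rw [Real.sign_of_neg (by linarith), Real.sign_of_neg (by exact_mod_cast h)]
  · simp [h, qint_zero]
  · rw [Real.sign_of_pos (qint_pos hv h), Real.sign_of_pos (by exact_mod_cast h)]

/-- Representatives of the roots up to nonzero scalars. -/
noncomputable def rootV (v : ℝ) (t : Fin 3) (k : ℤ) : Fin 3 → ℝ :=
  match t with
  | 0 => ![qint v k * v, 1 + v ^ 2 * qint v k, qint v k]
  | 1 => ![qint v k * v, v ^ 2 * qint v k, 1 + v ^ 2 * qint v k]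
  | 2 => ![qint v k * v, qint v k - 1, qint v k - 1]

lemma sigmaV_smul (v : ℝ) (j : Fin 3) (c : ℝ) (x : Fin 3 → ℝ) :
    sigmaV 2 v j (c • x) = c • sigmaV 2 v j x := by
  unfold sigmaV
  ext i
  simp [Fin.sum_univ_three]
  ring

lemma sigma_zero (v : ℝ) (x : Fin 3 → ℝ) :
    sigmaV 2 v 0 x = ![-x 0 + v⁻¹ * x 1 + v * x 2, x 1, x 2] := by
  ext i
  fin_cases i <;> simp [sigmaV, Cmat, Fin.sum_univ_three]
  ring

lemma sigma_one (v : ℝ) (x : Fin 3 → ℝ) :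
    sigmaV 2 v 1 x = ![x 0, v * x 0 - x 1 + x 2, x 2] := by
  ext i
  fin_cases i <;> simp [sigmaV, Cmat, Fin.sum_univ_three]
  ring

lemma sigma_two (v : ℝ) (x : Fin 3 → ℝ) :
    sigmaV 2 v 2 x = ![x 0, x 1, v⁻¹ * x 0 + x 1 - x 2] := by
  ext i
  fin_cases i <;> simp [sigmaV, Cmat, Fin.sum_univ_three]
  ring

lemma step (j t : Fin 3) (k : ℤ) : ∃ (t' : Fin 3) (k' : ℤ), ∀ v : ℝ, 0 < v →
    ∃ c : ℝ, 0 < c ∧ sigmaV 2 v j (rootV v t k) = (-c) • rootV v t' k' := by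
  have key : ∀ v : ℝ, 0 < v → qint v (-k) * (1 - (1 - v ^ 2) * qint v k) = - qint v k := by
    intro v hv
    rw [← zero_sub k, qint_sub hv, qint_zero, zero_sub]
  have key1 : ∀ v : ℝ, 0 < v →
      qint v (-1 - k) * (v ^ 2 * (1 - (1 - v ^ 2) * qint v k)) = - 1 - v ^ 2 * qint v k := by
    intro v hv
    have h := qint_sub hv (-1) k
    have h2 := qint_sub hv 0 1
    rw [qint_zero, qint_one] at h2
    norm_num at h2
    linear_combination v ^ 2 * h + h2
  have key2 : ∀ v : ℝ, 0 < v →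
      qint v (2 - k) * (1 - (1 - v ^ 2) * qint v k) = 1 + v ^ 2 - qint v k := by
    intro v hv
    have h := qint_sub hv 2 k
    have h2 := qint_add hv 1 1
    rw [qint_one] at h2
    norm_num at h2
    linear_combination h + h2
  fin_cases j
  · fin_cases t
    · refine ⟨1, -1 - k, fun v hv => ⟨_, qint_pos_aux hv k, ?_⟩⟩
      have h := key1 v hv
      have hv0 := hv.ne'
      simp only [Fin.zero_eta, Fin.mk_one, Fin.reduceFinMk, sigma_zero]
      ext i
      fin_cases i <;> simp [rootV] <;> field_simp <;> linear_combination h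
    · refine ⟨0, -1 - k, fun v hv => ⟨v ^ 2 * _, mul_pos (pow_pos hv 2) (qint_pos_aux hv k), ?_⟩⟩
      have h := key1 v hv
      have hv0 := hv.ne'
      simp only [Fin.zero_eta, Fin.mk_one, Fin.reduceFinMk, sigma_zero]
      ext i
      fin_cases i <;> simp [rootV] <;> field_simp <;> first
        | ring1
        | linear_combination (1) * h
    · refine ⟨2, 2 - k, fun v hv => ⟨_ / v ^ 2, div_pos (qint_pos_aux hv k) (pow_pos hv 2), ?_⟩⟩
      have h := key2 v hv
      have hv0 := hv.ne'
      simp only [Fin.zero_eta, Fin.mk_one, Fin.reduceFinMk, sigma_zero]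
      ext i
      fin_cases i <;> simp [rootV] <;> field_simp <;> first
        | ring1
        | linear_combination (1) * h
  · fin_cases t
    · refine ⟨0, -k, fun v hv => ⟨_, qint_pos_aux hv k, ?_⟩⟩
      have h := key v hv
      have hv0 := hv.ne'
      simp only [Fin.zero_eta, Fin.mk_one, Fin.reduceFinMk, sigma_one]
      ext i
      fin_cases i <;> simp [rootV] <;> first
        | ring1
        | (field_simp; ring1)
        | (field_simp; linear_combination h)
        | (field_simp; linear_combination -h)
        | (field_simp; linear_combination v ^ 2 * h)
    · refine ⟨2, -k, fun v hv => ⟨_, qint_pos_aux hv k, ?_⟩⟩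
      have h := key v hv
      have hv0 := hv.ne'
      simp only [Fin.zero_eta, Fin.mk_one, Fin.reduceFinMk, sigma_one]
      ext i
      fin_cases i <;> simp [rootV] <;> first
        | ring1
        | (field_simp; ring1)
        | (field_simp; linear_combination h)
    · refine ⟨1, -k, fun v hv => ⟨_, qint_pos_aux hv k, ?_⟩⟩
      have h := key v hv
      have hv0 := hv.ne'
      simp only [Fin.zero_eta, Fin.mk_one, Fin.reduceFinMk, sigma_one]
      ext i
      fin_cases i <;> simp [rootV] <;> first
        | ring1
        | (field_simp; ring1)
        | (field_simp; linear_combination h)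
        | (field_simp; linear_combination -h)
        | (field_simp; linear_combination v ^ 2 * h)
  · fin_cases t
    · refine ⟨2, -k, fun v hv => ⟨_, qint_pos_aux hv k, ?_⟩⟩
      have h := key v hv
      have hv0 := hv.ne'
      simp only [Fin.zero_eta, Fin.mk_one, Fin.reduceFinMk, sigma_two]
      ext i
      fin_cases i <;> simp [rootV] <;> first
        | ring1
        | (field_simp; ring1)
        | (field_simp; linear_combination h)
    · refine ⟨1, -k, fun v hv => ⟨_, qint_pos_aux hv k, ?_⟩⟩
      have h := key v hv
      have hv0 := hv.ne'
      simp only [Fin.zero_eta, Fin.mk_one, Fin.reduceFinMk, sigma_two]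
      ext i
      fin_cases i <;> simp [rootV] <;> first
        | ring1
        | (field_simp; ring1)
        | (field_simp; linear_combination h)
        | (field_simp; linear_combination -h)
        | (field_simp; linear_combination v ^ 2 * h)
    · refine ⟨0, -k, fun v hv => ⟨_, qint_pos_aux hv k, ?_⟩⟩
      have h := key v hv
      have hv0 := hv.ne'
      simp only [Fin.zero_eta, Fin.mk_one, Fin.reduceFinMk, sigma_two]
      ext i
      fin_cases i <;> simp [rootV] <;> first
        | ring1
        | (field_simp; ring1)
        | (field_simp; linear_combination h)
        | (field_simp; linear_combination -h)
        | (field_simp; linear_combination v ^ 2 * h)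

lemma word_root (w : List (Fin 3)) (i : Fin 3) :
    ∃ (t : Fin 3) (k : ℤ) (ε : ℝ), ∀ v : ℝ, 0 < v →
      ∃ c : ℝ, 0 < c ∧ rhoV 2 v w (Pi.single i 1) = (c * ε) • rootV v t k := by
  induction w with
  | nil =>
    fin_cases i
    · refine ⟨2, 1, 1, fun v hv => ⟨v⁻¹, inv_pos.2 hv, ?_⟩⟩
      ext i
      fin_cases i <;> simp [rhoV, rootV, qint_one, hv.ne']
    · refine ⟨0, 0, 1, fun v hv => ⟨1, one_pos, ?_⟩⟩
      ext i
      fin_cases i <;> simp [rhoV, rootV, qint_zero]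
    · refine ⟨1, 0, 1, fun v hv => ⟨1, one_pos, ?_⟩⟩
      ext i
      fin_cases i <;> simp [rhoV, rootV, qint_zero]
  | cons j w ih =>
    obtain ⟨t, k, ε, h⟩ := ih
    obtain ⟨t', k', h'⟩ := step j t k
    refine ⟨t', k', -ε, fun v hv => ?_⟩
    obtain ⟨c, hc, e⟩ := h v hv
    obtain ⟨d, hd, e'⟩ := h' v hv
    refine ⟨c * d, mul_pos hc hd, ?_⟩
    simp only [rhoV, Function.comp_apply]
    rw [e, sigmaV_smul, e', smul_smul]
    congr 1
    ring

/-- The determinant of three vectors, written out. -/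
noncomputable def det3 (x y z : Fin 3 → ℝ) : ℝ :=
  x 0 * (y 1 * z 2 - z 1 * y 2) - y 0 * (x 1 * z 2 - z 1 * x 2) + z 0 * (x 1 * y 2 - y 1 * x 2)

lemma detCols_eq (γ : Fin 3 → Fin 3 → ℝ) : detCols γ = det3 (γ 0) (γ 1) (γ 2) := by
  unfold detCols det3
  rw [Matrix.det_fin_three]
  simp
  ring

/-- The sign of the determinant of three root representatives is uniform in `v`. -/
def UniformSign (s t u : Fin 3) (a b c : ℤ) : Prop :=
  ∃ N : ℤ, ∀ v : ℝ, 0 < v →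
    Real.sign (det3 (rootV v s a) (rootV v t b) (rootV v u c)) = Real.sign (N : ℝ)

lemma UniformSign.swap01 {s t u : Fin 3} {a b c : ℤ} (h : UniformSign s t u a b c) :
    UniformSign t s u b a c := by
  obtain ⟨N, h⟩ := h
  refine ⟨-N, fun v hv => ?_⟩
  rw [Int.cast_neg, Real.sign_neg, ← h v hv, ← Real.sign_neg]
  congr 1
  unfold det3
  ring

lemma UniformSign.swap12 {s t u : Fin 3} {a b c : ℤ} (h : UniformSign s t u a b c) :
    UniformSign s u t a c b := by
  obtain ⟨N, h⟩ := h
  refine ⟨-N, fun v hv => ?_⟩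
  rw [Int.cast_neg, Real.sign_neg, ← h v hv, ← Real.sign_neg]
  congr 1
  unfold det3
  ring

lemma uniform_of {s t u : Fin 3} {a b c : ℤ} (N : ℤ)
    (h : ∀ v : ℝ, 0 < v → ∃ P : ℝ, 0 < P ∧
      det3 (rootV v s a) (rootV v t b) (rootV v u c) = P * qint v N) :
    UniformSign s t u a b c := by
  refine ⟨N, fun v hv => ?_⟩
  obtain ⟨P, hP, e⟩ := h v hv
  rw [e, sign_pos_mul hP, sign_qint hv]

lemma uniform_distinct (a b c : ℤ) : UniformSign 0 1 2 a b c := by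
  refine uniform_of (a + b + c) fun v hv => ⟨v, hv, ?_⟩
  rw [qint_add hv, qint_add hv]
  simp [rootV, det3]
  ring

lemma uniform_same (t : Fin 3) (a b c : ℤ) : UniformSign t t t a b c := by
  refine ⟨0, fun v hv => ?_⟩
  have : det3 (rootV v t a) (rootV v t b) (rootV v t c) = 0 := by
    fin_cases t <;> simp [rootV, det3] <;> ring
  simp [this]

lemma uniform_pair_next (t : Fin 3) (a b c : ℤ) : UniformSign t t (t + 1) a b c := by
  refine uniform_of (a - b) fun v hv =>
    ⟨v * (1 - (1 - v ^ 2) * qint v b) * (1 - (1 - v ^ 2) * qint v c),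
      mul_pos (mul_pos hv (qint_pos_aux hv b)) (qint_pos_aux hv c), ?_⟩
  have h := qint_sub hv a b
  fin_cases t <;> simp [rootV, det3] <;>
    linear_combination (-v * (1 - (1 - v ^ 2) * qint v c)) * h

lemma uniform_pair_prev (t : Fin 3) (a b c : ℤ) : UniformSign t t (t + 2) a b c := by
  refine uniform_of (b - a) fun v hv => ⟨v * (1 - (1 - v ^ 2) * qint v a),
    mul_pos hv (qint_pos_aux hv a), ?_⟩
  have h := qint_sub hv b a
  fin_cases t <;> simp [rootV, det3] <;>
  first
  | linear_combination (-v) * h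

lemma uniform_all (s t u : Fin 3) (a b c : ℤ) : UniformSign s t u a b c := by
  have pair : ∀ (t u : Fin 3) (a b c : ℤ), UniformSign t t u a b c := by
    intro t u a b c
    have : u = t ∨ u = t + 1 ∨ u = t + 2 := by decide +revert
    rcases this with rfl | rfl | rfl
    · exact uniform_same _ a b c
    · exact uniform_pair_next t a b c
    · exact uniform_pair_prev t a b c
  by_cases h1 : s = t
  · subst h1; exact pair s u a b c
  by_cases h2 : t = u
  · subst h2; exact (pair t s b c a).swap12.swap01
  by_cases h3 : s = u
  · subst h3; exact (pair s t a c b).swap12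
  have D := uniform_distinct
  have cases : (s = 0 ∧ t = 1 ∧ u = 2) ∨ (s = 0 ∧ t = 2 ∧ u = 1) ∨ (s = 1 ∧ t = 0 ∧ u = 2) ∨
      (s = 1 ∧ t = 2 ∧ u = 0) ∨ (s = 2 ∧ t = 0 ∧ u = 1) ∨ (s = 2 ∧ t = 1 ∧ u = 0) := by
    clear pair D
    revert s t u
    decide
  rcases cases with ⟨rfl, rfl, rfl⟩ | ⟨rfl, rfl, rfl⟩ | ⟨rfl, rfl, rfl⟩ | ⟨rfl, rfl, rfl⟩ |
    ⟨rfl, rfl, rfl⟩ | ⟨rfl, rfl, rfl⟩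
  · exact D a b c
  · exact (D a c b).swap12
  · exact (D b a c).swap01
  · exact (D c a b).swap01.swap12
  · exact (D b c a).swap12.swap01
  · exact (D c b a).swap12.swap01.swap12

lemma sign_real_mul (x y : ℝ) : Real.sign (x * y) = Real.sign x * Real.sign y := by
  rcases lt_trichotomy x 0 with h | h | h
  · rw [Real.sign_of_neg h, ← neg_neg (x * y), ← neg_mul, Real.sign_neg,
      sign_pos_mul (neg_pos.2 h)]
    ring
  · simp [h]
  · rw [Real.sign_of_pos h, sign_pos_mul h, one_mul]


/-- for `n = 2` and any `v, v' > 0`, the chirotope of the realized root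
system of type `Ã_2` with parameter `v` is independent of `v`: for all words
`w_0, w_1, w_2` and indices `i_0, i_1, i_2`,
`sign det(ρ_v(w_0)(α_{i_0}), ρ_v(w_1)(α_{i_1}), ρ_v(w_2)(α_{i_2}))
  = sign det(ρ_{v'}(w_0)(α_{i_0}), ρ_{v'}(w_1)(α_{i_1}), ρ_{v'}(w_2)(α_{i_2}))`. -/
theorem chirotope_indep_rank_two (v v' : ℝ) (hv : 0 < v) (hv' : 0 < v')
    (w : Fin 3 → List (Fin 3)) (idx : Fin 3 → Fin 3) :
    Real.sign (detCols fun l => rhoV 2 v (w l) (Pi.single (idx l) 1)) =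
    Real.sign (detCols fun l => rhoV 2 v' (w l) (Pi.single (idx l) 1)) := by
  choose t k ε h using fun l => word_root (w l) (idx l)
  obtain ⟨N, hN⟩ := uniform_all (t 0) (t 1) (t 2) (k 0) (k 1) (k 2)
  have main : ∀ v : ℝ, 0 < v →
      Real.sign (detCols fun l => rhoV 2 v (w l) (Pi.single (idx l) 1)) =
        Real.sign (ε 0 * ε 1 * ε 2) * Real.sign (N : ℝ) := by
    intro v hv
    choose c hc e using fun l => h l v hv
    have hP : 0 < c 0 * c 1 * c 2 := mul_pos (mul_pos (hc 0) (hc 1)) (hc 2)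
    rw [detCols_eq, e 0, e 1, e 2, ← hN v hv]
    rw [← sign_real_mul, ← sign_pos_mul (x := _ * det3 _ _ _) hP]
    congr 1
    simp only [det3, Pi.smul_apply, smul_eq_mul]
    ring
  rw [main v hv, main v' hv']
end

section
/- Let n ≥ 1 and let C be a real n×n matrix such that C_{ii} = 2 for all i, and for all i ≠ j: C_{ij} ≤ 0 and (C_{ij} = 0 if and only if C_{ji} = 0). Suppose the simple graph on the vertex set {1,…,n} in which distinct vertices i and j are adjacent exactly when C_{ij} ≠ 0 is acyclic (a forest). Then there exist positive real numbers d_1, …, d_n such that for all i and j, d_i · C_{ij} · d_j^{−1} = d_j · C_{ji} · d_i^{−1}; that is, the matrix with (i,j)-entry d_i C_{ij} d_j^{−1} is symmetric. -/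
theorem forest_potential {V : Type*} [Finite V] (w : V → V → ℝ) (G : SimpleGraph V)
    (hpos : ∀ i j, G.Adj i j → 0 < w i j) (hinv : ∀ i j, G.Adj i j → w i j * w j i = 1)
    (hG : G.IsAcyclic) :
    ∃ d : V → ℝ, (∀ i, 0 < d i) ∧ ∀ i j, G.Adj i j → d i = w i j * d j := by
  classical
  induction G using WellFoundedLT.induction with
  | ind G ih =>
  by_cases hbot : ∃ u v, G.Adj u v
  · obtain ⟨u, v, huv⟩ := hbot
    have hle : G.deleteEdges {s(u, v)} ≤ G := G.deleteEdges_le _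
    have hlt : G.deleteEdges {s(u, v)} < G := by
      refine lt_of_le_of_ne hle fun h => ?_
      have h2 := huv
      rw [← h] at h2
      simp at h2
    have hnr : ¬ (G.deleteEdges {s(u, v)}).Reachable u v := by
      have := SimpleGraph.isAcyclic_iff_forall_adj_isBridge.1 hG huv
      rw [SimpleGraph.isBridge_iff] at this
      exact this
    obtain ⟨d, hd, hd2⟩ := ih _ hlt (fun i j h => hpos i j (hle h))
      (fun i j h => hinv i j (hle h)) (hG.anti hle)
    generalize hH : G.deleteEdges {s(u, v)} = H at *
    have hw := hpos u v huv
    have hc : 0 < w u v * d v / d u := div_pos (mul_pos hw (hd v)) (hd u)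
    refine ⟨fun i => if H.Reachable u i then w u v * d v / d u * d i else d i, ?_, ?_⟩
    · intro i
      dsimp only
      split_ifs
      · exact mul_pos hc (hd i)
      · exact hd i
    · intro i j hij
      have hu : H.Reachable u u := SimpleGraph.Reachable.refl u
      have hdu := (hd u).ne'
      dsimp only
      by_cases he : s(i, j) = s(u, v)
      · rcases Sym2.eq_iff.1 he with ⟨rfl, rfl⟩ | ⟨rfl, rfl⟩
        · rw [if_pos hu, if_neg hnr]
          field_simp
        · rw [if_pos hu, if_neg hnr]
          have := hinv _ _ hij
          field_simp
          linear_combination (-d i) * this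
      · have hij' : H.Adj i j := by
          rw [← hH, SimpleGraph.deleteEdges_adj]
          exact ⟨hij, he⟩
        have h1 := hd2 i j hij'
        have : H.Reachable u i ↔ H.Reachable u j :=
          ⟨fun h => h.trans hij'.reachable, fun h => h.trans hij'.symm.reachable⟩
        by_cases hr : H.Reachable u j
        · rw [if_pos hr, if_pos (this.2 hr), h1]; ring
        · rw [if_neg hr, if_neg (fun h => hr (this.1 h)), h1]
  · push Not at hbot
    exact ⟨fun _ => 1, fun _ => one_pos, fun i j h => absurd h (hbot i j)⟩

/-- if `C` is a real `n×n` matrix (`n ≥ 1`) with `C_{ii} = 2`, `C_{ij} ≤ 0`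
for `i ≠ j`, `C_{ij} = 0 ↔ C_{ji} = 0`, and the graph on `{1,…,n}` joining `i ≠ j` exactly
when `C_{ij} ≠ 0` is acyclic (a forest), then there are positive reals `d_1, …, d_n` such
that the matrix with entries `d_i C_{ij} d_j⁻¹` is symmetric. -/
theorem forest_rescale_symmetric (n : ℕ) (hn : 1 ≤ n) (C : Matrix (Fin n) (Fin n) ℝ)
    (hdiag : ∀ i, C i i = 2)
    (hoff : ∀ i j, i ≠ j → C i j ≤ 0)
    (hzero : ∀ i j, i ≠ j → (C i j = 0 ↔ C j i = 0))
    (hforest : (SimpleGraph.fromRel fun i j : Fin n => C i j ≠ 0).IsAcyclic) :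
    ∃ d : Fin n → ℝ, (∀ i, 0 < d i) ∧
      ∀ i j, d i * C i j * (d j)⁻¹ = d j * C j i * (d i)⁻¹ := by
  have key : ∀ i j, (SimpleGraph.fromRel fun i j : Fin n => C i j ≠ 0).Adj i j →
      C i j < 0 ∧ C j i < 0 := by
    intro i j h
    rw [SimpleGraph.fromRel_adj] at h
    obtain ⟨hne, h⟩ := h
    have hz := hzero i j hne
    have h1 : C i j ≠ 0 := by tauto
    have h2 : C j i ≠ 0 := by tauto
    exact ⟨lt_of_le_of_ne (hoff i j hne) h1, lt_of_le_of_ne (hoff j i hne.symm) h2⟩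
  obtain ⟨D, hD, hD2⟩ := forest_potential (fun i j => C j i / C i j) _
    (fun i j h => div_pos_of_neg_of_neg (key i j h).2 (key i j h).1)
    (fun i j h => by
      have h1 := (key i j h).1.ne
      have h2 := (key i j h).2.ne
      field_simp) hforest
  refine ⟨fun i => Real.sqrt (D i), fun i => Real.sqrt_pos.2 (hD i), fun i j => ?_⟩
  by_cases hij : i = j
  · subst hij; rfl
  by_cases h0 : C i j = 0
  · simp [h0, (hzero i j hij).1 h0]
  have h := hD2 i j ((SimpleGraph.fromRel_adj _ _ _).2 ⟨hij, Or.inl h0⟩)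
  have hi := (Real.sqrt_pos.2 (hD i)).ne'
  have hj := (Real.sqrt_pos.2 (hD j)).ne'
  have e : D i * C i j = D j * C j i := by
    rw [h]; field_simp
  have si := Real.sq_sqrt (hD i).le
  have sj := Real.sq_sqrt (hD j).le
  dsimp only
  rw [← div_eq_mul_inv, ← div_eq_mul_inv, div_eq_div_iff hj hi]
  linear_combination e + C i j * si - C j i * sj
end

section
/- Let n ≥ 1 and let M be a Coxeter matrix of rank n. The set of all non-integral generalized Cartan matrices for M, regarded as a subset of the space of real n×n matrices with its standard topology, is path connected (and nonempty). -/
/-- `A` is a non-integral generalized Cartan matrix (NGCM) for the Coxeter matrix `M`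
(entries in `ℕ∞`, with `⊤` denoting `∞`): `A_{ii} = 2`; for `i ≠ j`, `A_{ij} ≤ 0` with
`A_{ij} = 0 ↔ M(i,j) = 2`; if `M(i,j) = m` is finite then `A_{ij} A_{ji} = 4cos²(π/m)`;
and if `M(i,j) = ∞` then `A_{ij} A_{ji} ≥ 4`. -/
def IsNGCM {n : ℕ} (M : Fin n → Fin n → ℕ∞) (A : Matrix (Fin n) (Fin n) ℝ) : Prop :=
  (∀ i, A i i = 2) ∧
  (∀ i j, i ≠ j → A i j ≤ 0) ∧
  (∀ i j, i ≠ j → (A i j = 0 ↔ M i j = 2)) ∧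
  (∀ i j, i ≠ j → ∀ m : ℕ, M i j = (m : ℕ∞) →
    A i j * A j i = 4 * Real.cos (Real.pi / (m : ℝ)) ^ 2) ∧
  (∀ i j, i ≠ j → M i j = ⊤ → 4 ≤ A i j * A j i)

noncomputable def ngcmBase {n : ℕ} (M : Fin n → Fin n → ℕ∞) : Matrix (Fin n) (Fin n) ℝ :=
  fun i j => if i = j then 2 else if M i j = ⊤ then -2 else
    -(2 * Real.cos (Real.pi / ((M i j).toNat : ℝ)))

noncomputable def ngcmPath {n : ℕ} (M : Fin n → Fin n → ℕ∞) (A B : Matrix (Fin n) (Fin n) ℝ)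
    (t : ℝ) : Matrix (Fin n) (Fin n) ℝ :=
  fun i j => if i = j then 2 else if M i j = 2 then 0 else
    -((-A i j) ^ (1 - t) * (-B i j) ^ t)

theorem cos_pi_div_pos (m : ℕ) (hm : 3 ≤ m) : 0 < Real.cos (Real.pi / (m : ℝ)) := by
  have hm' : (3 : ℝ) ≤ m := by exact_mod_cast hm
  have hp := Real.pi_pos
  apply Real.cos_pos_of_mem_Ioo
  constructor
  · have : 0 < Real.pi / (m : ℝ) := by positivity
    linarith
  · rw [div_lt_div_iff₀ (by linarith) (by norm_num)]
    nlinarith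

theorem ngcmBase_spec {n : ℕ} (M : Fin n → Fin n → ℕ∞)
    (hsymm : ∀ i j, M i j = M j i) (h2 : ∀ i j, i ≠ j → 2 ≤ M i j) :
    IsNGCM M (ngcmBase M) := by
  have key : ∀ i j, i ≠ j → ∀ m : ℕ, M i j = (m : ℕ∞) →
      ngcmBase M i j = -(2 * Real.cos (Real.pi / (m : ℝ))) ∧ 2 ≤ m := by
    intro i j hij m hm
    have h := h2 i j hij
    rw [hm] at h
    exact ⟨by simp [ngcmBase, hij, hm], by exact_mod_cast h⟩
  have top : ∀ i j, i ≠ j → M i j = ⊤ → ngcmBase M i j = -2 := by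
    intro i j hij hm
    simp [ngcmBase, hij, hm]
  have both : ∀ i j, i ≠ j → ngcmBase M i j ≤ 0 ∧ (ngcmBase M i j = 0 ↔ M i j = 2) := by
    intro i j hij
    rcases hM : M i j with _ | m
    · rw [top i j hij hM]
      norm_num
      intro h
      exact absurd h.symm (ENat.coe_ne_top 2)
    · obtain ⟨h, hm⟩ := key i j hij m hM
      rw [h]
      rcases hm.eq_or_lt with rfl | hm
      · simp
        rfl
      · have hc := cos_pi_div_pos m hm
        refine ⟨by linarith, fun h => by linarith, fun h => ?_⟩
        have : m = 2 := by exact_mod_cast (show (m : ℕ∞) = ((2 : ℕ) : ℕ∞) from h)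
        omega
  refine ⟨fun i => by simp [ngcmBase], fun i j hij => (both i j hij).1,
    fun i j hij => (both i j hij).2, ?_, ?_⟩
  · intro i j hij m hm
    rw [(key i j hij m hm).1, (key j i hij.symm m (by rw [hsymm, hm])).1]
    ring
  · intro i j hij hm
    rw [top i j hij hm, top j i hij.symm (by rw [hsymm, hm])]
    norm_num

theorem ngcmPath_spec {n : ℕ} (M : Fin n → Fin n → ℕ∞)
    (hsymm : ∀ i j, M i j = M j i) (A B : Matrix (Fin n) (Fin n) ℝ)
    (hA : IsNGCM M A) (hB : IsNGCM M B) (t : ℝ) (ht0 : 0 ≤ t) (ht1 : t ≤ 1) :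
    IsNGCM M (ngcmPath M A B t) := by
  obtain ⟨-, a2, a3, a4, a5⟩ := hA
  obtain ⟨-, b2, b3, b4, b5⟩ := hB
  have pa : ∀ i j, i ≠ j → M i j ≠ 2 → 0 < -A i j := fun i j hij h =>
    neg_pos.2 (lt_of_le_of_ne (a2 i j hij) (fun h' => h ((a3 i j hij).1 h')))
  have pb : ∀ i j, i ≠ j → M i j ≠ 2 → 0 < -B i j := fun i j hij h =>
    neg_pos.2 (lt_of_le_of_ne (b2 i j hij) (fun h' => h ((b3 i j hij).1 h')))
  have e2 : ∀ i j, i ≠ j → M i j = 2 → ngcmPath M A B t i j = 0 := by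
    intro i j hij h
    simp [ngcmPath, hij, h]
  have e3 : ∀ i j, i ≠ j → M i j ≠ 2 →
      ngcmPath M A B t i j = -((-A i j) ^ (1 - t) * (-B i j) ^ t) := by
    intro i j hij h
    simp [ngcmPath, hij, h]
  have neg : ∀ i j, i ≠ j → M i j ≠ 2 → ngcmPath M A B t i j < 0 := by
    intro i j hij h
    rw [e3 i j hij h]
    have := Real.rpow_pos_of_pos (pa i j hij h) (1 - t)
    have := Real.rpow_pos_of_pos (pb i j hij h) t
    apply neg_neg_of_pos
    positivity
  have prod : ∀ i j, i ≠ j → M i j ≠ 2 → ngcmPath M A B t i j * ngcmPath M A B t j i =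
      (A i j * A j i) ^ (1 - t) * (B i j * B j i) ^ t := by
    intro i j hij h
    have h' : M j i ≠ 2 := by rwa [hsymm]
    rw [e3 i j hij h, e3 j i hij.symm h', ← neg_mul_neg (A i j), ← neg_mul_neg (B i j),
      Real.mul_rpow (pa i j hij h).le (pa j i hij.symm h').le,
      Real.mul_rpow (pb i j hij h).le (pb j i hij.symm h').le]
    ring
  refine ⟨fun i => by simp [ngcmPath], ?_, ?_, ?_, ?_⟩
  · intro i j hij
    by_cases h : M i j = 2
    · exact (e2 i j hij h).le
    · exact (neg i j hij h).le
  · intro i j hij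
    exact ⟨fun h' => by_contra fun h => (neg i j hij h).ne h', e2 i j hij⟩
  · intro i j hij m hm
    by_cases h : M i j = 2
    · rw [e2 i j hij h, ← a4 i j hij m hm, (a3 i j hij).2 h, zero_mul, zero_mul]
    · rw [prod i j hij h, b4 i j hij m hm, ← a4 i j hij m hm]
      have hp : 0 < A i j * A j i := by
        rw [← neg_mul_neg]
        exact mul_pos (pa i j hij h) (pa j i hij.symm (by rwa [hsymm]))
      rw [← Real.rpow_add hp]
      simp
  · intro i j hij hm
    have h : M i j ≠ 2 := by
      rw [hm]
      exact fun h => absurd h.symm (ENat.coe_ne_top 2)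
    rw [prod i j hij h]
    calc (4 : ℝ) = 4 ^ (1 - t) * 4 ^ t := by
          rw [← Real.rpow_add (by norm_num)]
          simp
      _ ≤ _ := by
          have h1 := Real.rpow_le_rpow (by norm_num) (a5 i j hij hm) (sub_nonneg.2 ht1)
          have h2 := Real.rpow_le_rpow (by norm_num) (b5 i j hij hm) ht0
          exact mul_le_mul h1 h2 (by positivity) (le_trans (by positivity) h1)

theorem ngcmPath_continuous {n : ℕ} (M : Fin n → Fin n → ℕ∞)
    (A B : Matrix (Fin n) (Fin n) ℝ)
    (hA : IsNGCM M A) (hB : IsNGCM M B) : Continuous (ngcmPath M A B) := by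
  refine continuous_pi fun i => continuous_pi fun j => ?_
  unfold ngcmPath
  by_cases hij : i = j
  · simp only [hij, if_true]
    exact continuous_const
  by_cases h : M i j = 2
  · simp only [hij, h, if_true, if_false]
    exact continuous_const
  simp only [hij, h, if_false]
  have ha : -A i j ≠ 0 := neg_ne_zero.2 fun h' => h ((hA.2.2.1 i j hij).1 h')
  have hb : -B i j ≠ 0 := neg_ne_zero.2 fun h' => h ((hB.2.2.1 i j hij).1 h')
  exact ((Continuous.rpow continuous_const (continuous_const.sub continuous_id)
    fun _ => Or.inl ha).mul (Continuous.rpow continuous_const continuous_id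
    fun _ => Or.inl hb)).neg

/-- for a Coxeter matrix `M` of rank `n ≥ 1`, the set of all NGCMs for `M`
is a (nonempty) path-connected subset of the space of real `n×n` matrices. -/
theorem ngcm_isPathConnected (n : ℕ) (hn : 1 ≤ n) (M : Fin n → Fin n → ℕ∞)
    (hdiag : ∀ i, M i i = 1)
    (hsymm : ∀ i j, M i j = M j i)
    (h2 : ∀ i j, i ≠ j → 2 ≤ M i j) :
    IsPathConnected { A : Matrix (Fin n) (Fin n) ℝ | IsNGCM M A } := by
  refine ⟨ngcmBase M, ngcmBase_spec M hsymm h2, fun {B} hB => ?_⟩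
  have hA := ngcmBase_spec M hsymm h2
  refine JoinedIn.ofLine (f := ngcmPath M (ngcmBase M) B)
    (ngcmPath_continuous M _ B hA hB).continuousOn ?_ ?_ ?_
  · ext i j
    by_cases hij : i = j
    · subst hij
      simp [ngcmPath, hA.1]
    by_cases h : M i j = 2
    · simp [ngcmPath, hij, h, (hA.2.2.1 i j hij).2 h]
    · simp [ngcmPath, hij, h]
  · ext i j
    by_cases hij : i = j
    · subst hij
      simp [ngcmPath, hB.1]
    by_cases h : M i j = 2
    · simp [ngcmPath, hij, h, (hB.2.2.1 i j hij).2 h]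
    · simp [ngcmPath, hij, h]
  · rintro _ ⟨t, ht, rfl⟩
    exact ngcmPath_spec M hsymm _ B hA hB t ht.1 ht.2
end

section
/- Let M be a Coxeter matrix of rank 3 and let A and B be two non-integral generalized Cartan matrices for M. For a word w = (j_1,…,j_r) with letters in {1,2,3}, let ρ_A(w) = σ^A_{j_1} ∘ ⋯ ∘ σ^A_{j_r} and ρ_B(w) = σ^B_{j_1} ∘ ⋯ ∘ σ^B_{j_r} (the empty word gives the identity). Then for all words w_1, w_2, w_3 with letters in {1,2,3} and all indices i_1, i_2, i_3 ∈ {1,2,3}, sign( det( ρ_A(w_1)(e_{i_1}), ρ_A(w_2)(e_{i_2}), ρ_A(w_3)(e_{i_3}) ) ) = sign( det( ρ_B(w_1)(e_{i_1}), ρ_B(w_2)(e_{i_2}), ρ_B(w_3)(e_{i_3}) ) ), where sign takes values in {−1, 0, 1}. (In other words, all realized root systems of a rank 3 Coxeter system determine the same oriented matroid structure.) -/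
/-- The simple reflection `σ^A_i : x ↦ x - (∑_j A_{ji} x_j) e_i` attached to an NGCM `A`. -/
noncomputable def sigmaA (A : Matrix (Fin 3) (Fin 3) ℝ) (i : Fin 3) :
    (Fin 3 → ℝ) → (Fin 3 → ℝ) :=
  fun x => x - (∑ j, A j i * x j) • (Pi.single i 1 : Fin 3 → ℝ)

/-- `ρ_A(w) = σ^A_{j_1} ∘ ⋯ ∘ σ^A_{j_r}` for a word `w = (j_1, …, j_r)`. -/
noncomputable def rhoA (A : Matrix (Fin 3) (Fin 3) ℝ) : List (Fin 3) → (Fin 3 → ℝ) → (Fin 3 → ℝ)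
  | [] => id
  | j :: w => sigmaA A j ∘ rhoA A w


namespace RankThree

open CoxeterSystem

/-- The ambient space. -/
abbrev V3 := Fin 3 → ℝ

/-- Standard basis vectors. -/
noncomputable def bv (i : Fin 3) : V3 := Pi.single i 1

lemma bv_nonneg (i : Fin 3) : 0 ≤ bv i := by
  unfold bv; exact Pi.single_nonneg.2 zero_le_one

/-- The simple coroot functional. -/
noncomputable def cor (A : Matrix (Fin 3) (Fin 3) ℝ) (i : Fin 3) : V3 →ₗ[ℝ] ℝ :=
  ∑ j, A j i • LinearMap.proj j

lemma cor_apply (A : Matrix (Fin 3) (Fin 3) ℝ) (i : Fin 3) (x : V3) :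
    cor A i x = ∑ j, A j i * x j := by
  simp [cor]

lemma cor_bv (A : Matrix (Fin 3) (Fin 3) ℝ) (i j : Fin 3) : cor A i (bv j) = A j i := by
  simp [cor_apply, bv, Pi.single_apply]

/-- The simple reflection as a linear map. -/
noncomputable def sig (A : Matrix (Fin 3) (Fin 3) ℝ) (i : Fin 3) : Module.End ℝ V3 :=
  Module.preReflection (bv i) (cor A i)

lemma sig_apply (A : Matrix (Fin 3) (Fin 3) ℝ) (i : Fin 3) (x : V3) :
    sig A i x = x - cor A i x • bv i := by
  simp [sig, Module.preReflection_apply]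

/-- A convenient reformulation of the generalized Cartan matrix conditions. -/
structure Good (M : CoxeterMatrix (Fin 3)) (A : Matrix (Fin 3) (Fin 3) ℝ) : Prop where
  diag : ∀ i, A i i = 2
  off : ∀ i j, i ≠ j → ∃ r c : ℝ, 0 < r ∧ A i j = -(r * c) ∧ A j i = -(c / r) ∧
    ((M i j ≠ 0 ∧ c = 2 * Real.cos (Real.pi / M i j)) ∨ (M i j = 0 ∧ 2 ≤ c))

variable {M : CoxeterMatrix (Fin 3)} {A : Matrix (Fin 3) (Fin 3) ℝ}

lemma two_le_M {i j : Fin 3} (h : i ≠ j) (h0 : M i j ≠ 0) : 2 ≤ M i j := by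
  have := M.off_diagonal i j h
  have : M i j ≠ 1 := this
  omega

lemma S_pair_vanish (m : ℕ) (hm : 3 ≤ m) (t : ℝ) (ht : t = 2 * Real.cos (2 * Real.pi / m)) :
    ((Polynomial.Chebyshev.S ℝ (((m : ℤ) - 2) / 2)).eval t *
      ((Polynomial.Chebyshev.S ℝ (((m : ℤ) - 1) / 2)).eval t +
        (Polynomial.Chebyshev.S ℝ (((m : ℤ) - 3) / 2)).eval t)) = 0 ∧
    ((Polynomial.Chebyshev.S ℝ (((m : ℤ) - 1) / 2)).eval t *
      ((Polynomial.Chebyshev.S ℝ ((m : ℤ) / 2)).eval t +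
        (Polynomial.Chebyshev.S ℝ (((m : ℤ) - 2) / 2)).eval t)) = 0 := by
  have hm0 : (0 : ℝ) < m := by positivity
  have hm3 : (3 : ℝ) ≤ m := by exact_mod_cast hm
  have hs : 0 < Real.sin (2 * Real.pi / m) := by
    apply Real.sin_pos_of_pos_of_lt_pi
    · have := Real.pi_pos; positivity
    · rw [div_lt_iff₀ hm0]; nlinarith [Real.pi_pos]
  have key : ∀ n : ℤ, (Polynomial.Chebyshev.S ℝ n).eval t * Real.sin (2 * Real.pi / m)
      = Real.sin ((n + 1) * (2 * Real.pi / m)) := by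
    intro n; rw [ht]; exact Polynomial.Chebyshev.S_two_mul_real_cos _ n
  rcases Nat.even_or_odd' m with ⟨k, hk | hk⟩
  · have hkR : (m : ℝ) = 2 * k := by rw [hk]; push_cast; ring
    have hk0 : (k : ℝ) ≠ 0 := by intro h; rw [h] at hkR; linarith
    have e1 : ((m : ℤ) - 2) / 2 = (k : ℤ) - 1 := by omega
    have e2 : ((m : ℤ) - 1) / 2 = (k : ℤ) - 1 := by omega
    have hz : (Polynomial.Chebyshev.S ℝ ((k : ℤ) - 1)).eval t = 0 := by
      have := key ((k : ℤ) - 1)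
      have h2 : (((((k : ℤ) - 1 : ℤ) : ℝ) + 1) * (2 * Real.pi / m)) = Real.pi := by
        rw [hkR]; push_cast; field_simp; ring
      rw [h2, Real.sin_pi] at this
      exact (mul_eq_zero.1 this).resolve_right hs.ne'
    rw [e1, e2, hz]; simp
  · have hkR : (m : ℝ) = 2 * k + 1 := by rw [hk]; push_cast; ring
    have e1 : ((m : ℤ) - 2) / 2 = (k : ℤ) - 1 := by omega
    have e2 : ((m : ℤ) - 1) / 2 = (k : ℤ) := by omega
    have e3 : ((m : ℤ) - 3) / 2 = (k : ℤ) - 1 := by omega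
    have e4 : ((m : ℤ)) / 2 = (k : ℤ) := by omega
    have hz : (Polynomial.Chebyshev.S ℝ (k : ℤ)).eval t +
        (Polynomial.Chebyshev.S ℝ ((k : ℤ) - 1)).eval t = 0 := by
      have a1 := key (k : ℤ)
      have a2 := key ((k : ℤ) - 1)
      have h2 : (((((k : ℤ) - 1 : ℤ) : ℝ) + 1) * (2 * Real.pi / m)) = Real.pi - Real.pi / m := by
        have : (k : ℝ) = (m - 1) / 2 := by linarith
        push_cast; rw [this]; field_simp; ring
      have h1 : (((((k : ℤ) : ℤ) : ℝ) + 1) * (2 * Real.pi / m)) = Real.pi / m + Real.pi := by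
        have : (k : ℝ) = (m - 1) / 2 := by linarith
        push_cast; rw [this]; field_simp; ring
      rw [h2, Real.sin_pi_sub] at a2
      rw [h1, Real.sin_add_pi] at a1
      have : ((Polynomial.Chebyshev.S ℝ (k : ℤ)).eval t +
        (Polynomial.Chebyshev.S ℝ ((k : ℤ) - 1)).eval t) * Real.sin (2 * Real.pi / m) = 0 := by
        rw [add_mul, a1, a2]; ring
      exact (mul_eq_zero.1 this).resolve_right hs.ne'
    rw [e1, e2, e3, e4, hz]; simp

lemma sig_sq (hA : Good M A) (i : Fin 3) : sig A i * sig A i = 1 := by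
  have h2 : cor A i (bv i) = 2 := by rw [cor_bv]; exact hA.diag i
  exact LinearMap.ext fun x => Module.involutive_preReflection h2 x

lemma liftable (hA : Good M A) : M.IsLiftable (sig A) := by
  intro i j
  by_cases hij : i = j
  · subst hij
    rw [M.diagonal, pow_one, sig_sq hA]
  obtain ⟨r, c, hr, h1, h2, h3⟩ := hA.off i j hij
  rcases h3 with ⟨hm, hc⟩ | ⟨hm, -⟩
  swap
  · rw [hm, pow_zero]
  have hm2 := two_le_M hij hm
  have hi : cor A i (bv i) = 2 := by rw [cor_bv]; exact hA.diag i
  have hj : cor A j (bv j) = 2 := by rw [cor_bv]; exact hA.diag j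
  have hprod : cor A i (bv j) * cor A j (bv i) - 2 = 2 * Real.cos (2 * Real.pi / (M i j : ℕ)) := by
    rw [cor_bv, cor_bv, h1, h2]
    have : 2 * Real.pi / (M i j : ℕ) = 2 * (Real.pi / (M i j : ℕ)) := by ring
    rw [this, Real.cos_two_mul]
    field_simp
    rw [hc]; ring
  have hlin : ∀ n, (sig A i * sig A j) ^ n =
      ((Module.reflection hi * Module.reflection hj) ^ n).toLinearMap := by
    intro n
    induction n with
    | zero => rfl
    | succ n ih => rw [pow_succ, pow_succ, ih]; rfl
  rw [hlin]
  refine LinearMap.ext fun x => ?_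
  rcases Nat.lt_or_ge 2 (M i j) with h | h
  · have := Module.reflection_mul_reflection_pow_apply hi hj (M i j) x
    obtain ⟨z1, z2⟩ := S_pair_vanish (M i j) h _ hprod
    rw [z1, z2] at this
    simpa using this
  · have hM : M i j = 2 := le_antisymm h hm2
    have hc0 : c = 0 := by rw [hc, hM]; simp
    have hj' : cor A i (bv j) = 0 := by rw [cor_bv, h2, hc0]; simp
    have hi' : cor A j (bv i) = 0 := by rw [cor_bv, h1, hc0]; simp
    have hM2 : M.M i j = 2 := hM
    simp only [hM2, pow_two]
    change Module.reflection hi (Module.reflection hj (Module.reflection hi (Module.reflection hj x))) = x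
    simp only [Module.reflection_apply, map_sub, map_smul, hi, hj, hi', hj']
    module

variable {W : Type} [Group W] (cs : CoxeterSystem M W)

/-- The representation of the Coxeter group attached to `A`. -/
noncomputable def rep (hA : Good M A) : W →* Module.End ℝ V3 := cs.lift ⟨sig A, liftable hA⟩

lemma rep_simple (hA : Good M A) (i : Fin 3) : rep cs hA (cs.simple i) = sig A i :=
  cs.lift_apply_simple (liftable hA) i

lemma rep_mul (hA : Good M A) (u v : W) (x : V3) :
    rep cs hA (u * v) x = rep cs hA u (rep cs hA v x) := by
  rw [map_mul]; rfl

lemma rep_one (hA : Good M A) (x : V3) : rep cs hA 1 x = x := by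
  rw [map_one]; rfl

lemma rep_inv_cancel (hA : Good M A) (u : W) (x : V3) :
    rep cs hA u⁻¹ (rep cs hA u x) = x := by
  rw [← rep_mul, inv_mul_cancel, rep_one]

lemma rep_cancel_inv (hA : Good M A) (u : W) (x : V3) :
    rep cs hA u (rep cs hA u⁻¹ x) = x := by
  rw [← rep_mul, mul_inv_cancel, rep_one]

/-- Chebyshev-like sequence. -/
noncomputable def chU (c : ℝ) : ℕ → ℝ
  | 0 => 0
  | 1 => 1
  | n + 2 => c * chU c (n + 1) - chU c n

lemma chU_nonneg_of_two_le {c : ℝ} (hc : 2 ≤ c) (n : ℕ) :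
    0 ≤ chU c n ∧ chU c n ≤ chU c (n + 1) := by
  induction n with
  | zero => simp [chU]
  | succ n ih =>
    obtain ⟨h1, h2⟩ := ih
    refine ⟨h1.trans h2, ?_⟩
    rw [chU]
    nlinarith

lemma chU_sin (θ : ℝ) (n : ℕ) :
    chU (2 * Real.cos θ) n * Real.sin θ = Real.sin (n * θ) ∧
    chU (2 * Real.cos θ) (n + 1) * Real.sin θ = Real.sin ((n + 1 : ℕ) * θ) := by
  induction n with
  | zero => simp [chU]
  | succ n ih =>
    obtain ⟨h1, h2⟩ := ih
    refine ⟨h2, ?_⟩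
    rw [chU, sub_mul, mul_assoc, h1, h2]
    have e1 : ((n + 1 + 1 : ℕ) : ℝ) * θ = (n + 1 : ℕ) * θ + θ := by push_cast; ring
    have e2 : (n : ℝ) * θ = (n + 1 : ℕ) * θ - θ := by push_cast; ring
    rw [e1, e2, Real.sin_add, Real.sin_sub]
    ring

lemma chU_nonneg_cos {m : ℕ} (hm : 2 ≤ m) {n : ℕ} (hn : n ≤ m) :
    0 ≤ chU (2 * Real.cos (Real.pi / m)) n := by
  have hm0 : (0 : ℝ) < m := by positivity
  have hm2 : (2 : ℝ) ≤ m := by exact_mod_cast hm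
  have hnR : (n : ℝ) ≤ m := by exact_mod_cast hn
  have hs : 0 < Real.sin (Real.pi / m) := by
    apply Real.sin_pos_of_pos_of_lt_pi
    · have := Real.pi_pos; positivity
    · rw [div_lt_iff₀ hm0]; nlinarith [Real.pi_pos]
  have h := (chU_sin (Real.pi / m) n).1
  have h2 : 0 ≤ Real.sin (n * (Real.pi / m)) := by
    apply Real.sin_nonneg_of_nonneg_of_le_pi
    · have := Real.pi_pos; positivity
    · rw [← mul_div_assoc, div_le_iff₀ hm0]; nlinarith [Real.pi_pos]
  rw [← h] at h2
  exact nonneg_of_mul_nonneg_left h2 hs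

lemma alt_apply (hA : Good M A) {i t : Fin 3} {r c : ℝ} (hr : 0 < r)
    (h1 : A i t = -(r * c)) (h2 : A t i = -(c / r)) (k : ℕ) :
    rep cs hA (cs.wordProd (alternatingWord i t k)) (bv i) =
      if Even k then chU c (k + 1) • bv i + (r * chU c k) • bv t
      else chU c k • bv i + (r * chU c (k + 1)) • bv t := by
  induction k with
  | zero => simp [alternatingWord, chU]
  | succ k ih =>
    rw [alternatingWord_succ', cs.wordProd_cons, rep_mul, ih]
    by_cases hk : Even k
    · have hk' : ¬ Even (k + 1) := by simp [hk, parity_simps]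
      simp only [hk, hk', if_true, if_false, rep_simple, sig_apply, map_add, map_smul, cor_bv,
        h1, hA.diag, chU]
      ext l
      simp only [Pi.add_apply, Pi.sub_apply, Pi.smul_apply, smul_eq_mul]
      ring
    · have hk' : Even (k + 1) := by simp [hk, parity_simps]
      simp only [hk, hk', if_true, if_false, rep_simple, sig_apply, map_add, map_smul, cor_bv,
        h2, hA.diag, chU]
      ext l
      simp only [Pi.add_apply, Pi.sub_apply, Pi.smul_apply, smul_eq_mul]
      field_simp
      ring

lemma alt_pos (hA : Good M A) {i t : Fin 3} (hit : i ≠ t) (k : ℕ) (hk : M i t = 0 ∨ k < M i t) :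
    ∃ x y : ℝ, 0 ≤ x ∧ 0 ≤ y ∧
      rep cs hA (cs.wordProd (alternatingWord i t k)) (bv i) = x • bv i + y • bv t := by
  obtain ⟨r, c, hr, h1, h2, h3⟩ := hA.off i t hit
  have hU : 0 ≤ chU c k ∧ 0 ≤ chU c (k + 1) := by
    rcases h3 with ⟨hm, hc⟩ | ⟨hm, hc⟩
    · have hk' : k < M i t := hk.resolve_left hm
      have := two_le_M hit hm
      rw [hc]
      exact ⟨chU_nonneg_cos this hk'.le, chU_nonneg_cos this hk'⟩
    · exact ⟨(chU_nonneg_of_two_le hc k).1, (chU_nonneg_of_two_le hc (k+1)).1⟩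
  have := alt_apply cs hA hr h1 h2 k
  by_cases hk : Even k
  · rw [if_pos hk] at this
    exact ⟨_, _, hU.2, mul_nonneg hr.le hU.1, this⟩
  · rw [if_neg hk] at this
    exact ⟨_, _, hU.1, mul_nonneg hr.le hU.2, this⟩

theorem pos_of_length (hA : Good M A) (n : ℕ) : ∀ (w : W) (i : Fin 3), cs.length w = n →
    cs.length w < cs.length (w * cs.simple i) → 0 ≤ rep cs hA w (bv i) := by
  induction n using Nat.strong_induction_on with
  | _ n IH =>
  intro w i hn hlt
  by_cases hw : w = 1
  · subst hw; rw [rep_one]; exact bv_nonneg i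
  obtain ⟨t, ht⟩ := cs.exists_rightDescent_of_ne_one hw
  have hit : i ≠ t := by
    rintro rfl; unfold IsRightDescent at ht; omega
  let P : ℕ → Prop := fun k => ∃ v, w = v * cs.wordProd (alternatingWord i t k) ∧
    cs.length v + k = cs.length w
  have P1 : P 1 := by
    refine ⟨w * cs.simple t, ?_, ?_⟩
    · simp [alternatingWord]
    · exact cs.isRightDescent_iff.1 ht
  classical
  have hl1 : 1 ≤ cs.length w := by
    rw [cs.isRightDescent_iff] at ht; omega
  set k := Nat.findGreatest P (cs.length w) with hkdef
  have hPk : P k := Nat.findGreatest_spec hl1 P1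
  have hk1 : 1 ≤ k := Nat.le_findGreatest hl1 P1
  have hmax : ¬ P (k + 1) := by
    intro h
    have hle : k + 1 ≤ cs.length w := by obtain ⟨v, -, h⟩ := h; omega
    have := Nat.le_findGreatest hle h
    omega
  obtain ⟨v, hwv, hlen⟩ := hPk
  -- first letter
  have hA1 : ¬ cs.IsRightDescent v (if Even k then t else i) := by
    intro h
    apply hmax
    refine ⟨v * cs.simple (if Even k then t else i), ?_, ?_⟩
    · rw [alternatingWord_succ', cs.wordProd_cons, ← mul_assoc, cs.simple_mul_simple_cancel_right]
      exact hwv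
    · have := cs.isRightDescent_iff.1 h; omega
  have hA2 : ¬ cs.IsRightDescent v (if Even k then i else t) := by
    intro h
    obtain ⟨k', hk'⟩ : ∃ k', k = k' + 1 := ⟨k - 1, by omega⟩
    rw [hk'] at hwv h hlen
    rw [alternatingWord_succ', cs.wordProd_cons] at hwv
    have hl : (if Even (k' + 1) then i else t) = (if Even k' then t else i) := by
      by_cases hk : Even k' <;> simp [hk, parity_simps]
    rw [hl] at h
    have hr := cs.isRightDescent_iff.1 h
    have h5 := cs.length_mul_le (v * cs.simple (if Even k' then t else i))
      (cs.wordProd (alternatingWord i t k'))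
    rw [mul_assoc, ← hwv] at h5
    have h6 := cs.length_wordProd_le (alternatingWord i t k')
    rw [length_alternatingWord] at h6
    omega
  have hdes : ¬ cs.IsRightDescent v i ∧ ¬ cs.IsRightDescent v t := by
    by_cases hk : Even k
    · simp only [hk, if_true] at hA1 hA2; exact ⟨hA2, hA1⟩
    · simp only [hk, if_false] at hA1 hA2; exact ⟨hA1, hA2⟩
  have hvi : 0 ≤ rep cs hA v (bv i) := by
    refine IH (cs.length v) (by omega) v i rfl ?_
    have := cs.not_isRightDescent_iff.1 hdes.1; omega
  have hvt : 0 ≤ rep cs hA v (bv t) := by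
    refine IH (cs.length v) (by omega) v t rfl ?_
    have := cs.not_isRightDescent_iff.1 hdes.2; omega
  have hkM : M i t = 0 ∨ k < M i t := by
    by_contra hcon
    push Not at hcon
    obtain ⟨hM0, hMk⟩ := hcon
    have hM0' : M t i ≠ 0 := by rwa [M.symmetric]
    have hMk' : k + 1 > M t i := by rw [M.symmetric]; omega
    have hnr := cs.not_isReduced_alternatingWord t i hM0' hMk'
    have h6 := cs.length_wordProd_le (alternatingWord t i (k + 1))
    unfold CoxeterSystem.IsReduced at hnr
    rw [length_alternatingWord] at h6 hnr
    have h7 : w * cs.simple i = v * cs.wordProd (alternatingWord t i (k + 1)) := by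
      rw [alternatingWord_succ, cs.wordProd_concat, ← mul_assoc, ← hwv]
    have h8 := cs.length_mul_le v (cs.wordProd (alternatingWord t i (k + 1)))
    rw [← h7] at h8
    omega
  obtain ⟨x, y, hx, hy, hxy⟩ := alt_pos cs hA hit k hkM
  rw [hwv, rep_mul, hxy, map_add, map_smul, map_smul]
  exact add_nonneg (smul_nonneg hx hvi) (smul_nonneg hy hvt)

lemma sig_bv_self (hA : Good M A) (i : Fin 3) : sig A i (bv i) = - bv i := by
  rw [sig_apply, cor_bv, hA.diag]; module

lemma neg_of_descent (hA : Good M A) {w : W} {i : Fin 3} (h : cs.IsRightDescent w i) :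
    rep cs hA w (bv i) ≤ 0 := by
  have h1 : cs.length (w * cs.simple i) < cs.length (w * cs.simple i * cs.simple i) := by
    rw [cs.simple_mul_simple_cancel_right]; exact h
  have := pos_of_length cs hA _ (w * cs.simple i) i rfl h1
  rw [rep_mul, rep_simple, sig_bv_self hA, map_neg] at this
  exact neg_nonneg.1 this

/-- `β` is a root with reflection `t`. -/
def IsRt (hA : Good M A) (t : W) (β : V3) : Prop :=
  ∃ u i, t = u * cs.simple i * u⁻¹ ∧ β = rep cs hA u (bv i)

variable {cs}

lemma IsRt.simple (hA : Good M A) (i : Fin 3) : IsRt cs hA (cs.simple i) (bv i) :=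
  ⟨1, i, by simp, by rw [rep_one]⟩

lemma IsRt.neg {hA : Good M A} {t : W} {β : V3} (h : IsRt cs hA t β) : IsRt cs hA t (-β) := by
  obtain ⟨u, i, rfl, rfl⟩ := h
  refine ⟨u * cs.simple i, i, ?_, ?_⟩
  · simp [mul_assoc]
  · rw [rep_mul, rep_simple, sig_bv_self hA, map_neg]

lemma IsRt.act {hA : Good M A} {t : W} {β : V3} (h : IsRt cs hA t β) (w : W) :
    IsRt cs hA (w * t * w⁻¹) (rep cs hA w β) := by
  obtain ⟨u, i, rfl, rfl⟩ := h
  refine ⟨w * u, i, by group, by rw [rep_mul]⟩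

lemma bv_ne_zero (i : Fin 3) : bv i ≠ 0 := by
  intro h
  have := congrFun h i
  simp [bv] at this

lemma IsRt.ne_zero {hA : Good M A} {t : W} {β : V3} (h : IsRt cs hA t β) : β ≠ 0 := by
  obtain ⟨u, i, rfl, rfl⟩ := h
  intro h
  have := rep_inv_cancel cs hA u (bv i)
  rw [h, map_zero] at this
  exact bv_ne_zero i this.symm

lemma IsRt.dich {hA : Good M A} {t : W} {β : V3} (h : IsRt cs hA t β) : 0 ≤ β ∨ β ≤ 0 := by
  obtain ⟨u, i, rfl, rfl⟩ := h
  by_cases hd : cs.IsRightDescent u i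
  · exact Or.inr (neg_of_descent cs hA hd)
  · left
    apply pos_of_length cs hA _ u i rfl
    have := cs.not_isRightDescent_iff.1 hd; omega

lemma IsRt.refl {hA : Good M A} {t : W} {β : V3} (h : IsRt cs hA t β) :
    ∃ f : V3 →ₗ[ℝ] ℝ, f β = 2 ∧ ∀ x, rep cs hA t x = x - f x • β := by
  obtain ⟨u, i, rfl, rfl⟩ := h
  refine ⟨(cor A i).comp (rep cs hA u⁻¹), ?_, ?_⟩
  · rw [LinearMap.comp_apply, rep_inv_cancel, cor_bv, hA.diag]
  · intro x
    rw [rep_mul, rep_mul, rep_simple, sig_apply, map_sub, map_smul, rep_cancel_inv]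
    rfl

lemma IsRt.sq {hA : Good M A} {t : W} {β : V3} (h : IsRt cs hA t β) : t * t = 1 := by
  obtain ⟨u, i, rfl, rfl⟩ := h
  simp [mul_assoc]

lemma IsRt.inv_eq {hA : Good M A} {t : W} {β : V3} (h : IsRt cs hA t β) : t⁻¹ = t :=
  inv_eq_of_mul_eq_one_left h.sq

lemma eq_one_of_diag (hA : Good M A) (y : W) (h : ∀ k, 0 < rep cs hA y (bv k) k) : y = 1 := by
  by_contra hne
  obtain ⟨k, hk⟩ := cs.exists_rightDescent_of_ne_one hne
  have := neg_of_descent cs hA hk k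
  have h2 := h k
  simp only [Pi.zero_apply] at this
  linarith

lemma uniq_simple {hA : Good M A} {t : W} {c : ℝ} {j : Fin 3} (h : IsRt cs hA t (c • bv j)) :
    t = cs.simple j := by
  obtain ⟨f, hf, hr⟩ := h.refl
  have hy : cs.simple j * t = 1 := by
    apply eq_one_of_diag hA
    intro k
    rw [map_smul, smul_eq_mul] at hf
    rw [rep_mul, rep_simple, hr, map_sub, map_smul, map_smul, sig_bv_self hA, sig_apply, cor_bv]
    by_cases hkj : k = j
    · subst hkj
      rw [hA.diag]
      have hf' : c * f (Pi.single k 1) = 2 := hf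
      simp [bv]
      linarith
    · simp [bv, hkj]
  have := cs.simple_mul_simple_self j
  rw [← this] at hy
  exact mul_left_cancel hy

lemma IsRt.uniq {hA : Good M A} {t t' : W} {β β' : V3} {c : ℝ} (h : IsRt cs hA t β)
    (h' : IsRt cs hA t' β') (hc : β = c • β') : t = t' := by
  obtain ⟨u, i, rfl, rfl⟩ := h'
  have h2 := h.act u⁻¹
  rw [hc, map_smul, rep_inv_cancel] at h2
  rw [← uniq_simple h2]
  group

lemma flip_simple {A : Matrix (Fin 3) (Fin 3) ℝ} {j : Fin 3} {β : V3} (h0 : 0 ≤ β)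
    (h1 : sig A j β ≤ 0) : β = β j • bv j := by
  ext k
  by_cases hk : k = j
  · subst hk; simp [bv]
  · have a := h0 k
    have b := h1 k
    rw [sig_apply] at b
    simp [bv, hk] at a b ⊢
    linarith

lemma exchange_word {hA : Good M A} {t : W} {β : V3} (h : IsRt cs hA t β) (h0 : 0 ≤ β)
    (ω : List (Fin 3)) (hω : rep cs hA (cs.wordProd ω) β ≤ 0) :
    ∃ ω' : List (Fin 3), ω'.length < ω.length ∧ cs.wordProd ω * t = cs.wordProd ω' := by
  induction ω with
  | nil =>
    exfalso
    rw [cs.wordProd_nil, rep_one] at hω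
    exact h.ne_zero (le_antisymm hω h0)
  | cons j ω ih =>
    rcases (h.act (cs.wordProd ω)).dich with hp | hn
    · rw [cs.wordProd_cons, rep_mul, rep_simple] at hω
      have h3 := flip_simple hp hω
      have h4 := (h.act (cs.wordProd ω)).uniq (IsRt.simple hA j) h3
      refine ⟨ω, by simp, ?_⟩
      rw [cs.wordProd_cons, ← h4]
      have := h.sq
      simp [mul_assoc, this]
    · obtain ⟨ω', hl, he⟩ := ih hn
      refine ⟨j :: ω', by simpa using hl, ?_⟩
      rw [cs.wordProd_cons, cs.wordProd_cons, mul_assoc, he]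

lemma IsRt.exchange {hA : Good M A} {t : W} {β : V3} (h : IsRt cs hA t β) (h0 : 0 ≤ β)
    {w : W} (hw : rep cs hA w β ≤ 0) : cs.length (w * t) < cs.length w := by
  obtain ⟨ω, hr, rfl⟩ := cs.exists_isReduced w
  obtain ⟨ω', hl, he⟩ := exchange_word h h0 ω hw
  rw [he, hr.eq]
  exact lt_of_le_of_lt (cs.length_wordProd_le ω') hl

lemma finite_inv (hA : Good M A) (φ : V3 → ℝ) (hφ : ∀ (c : ℝ) v, c ≠ 0 → φ (c • v) = φ v)
    (w : W) : {q | ∃ t β, IsRt cs hA t β ∧ 0 ≤ β ∧ rep cs hA w β ≤ 0 ∧ φ β = q}.Finite := by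
  obtain ⟨ω, -, rfl⟩ := cs.exists_isReduced w
  induction ω with
  | nil =>
    convert Set.finite_empty
    rw [Set.eq_empty_iff_forall_notMem]
    rintro q ⟨t, β, h, h0, hω, -⟩
    rw [cs.wordProd_nil, rep_one] at hω
    exact h.ne_zero (le_antisymm hω h0)
  | cons j ω ih =>
    refine (ih.union (Set.finite_singleton (φ (rep cs hA (cs.wordProd ω)⁻¹ (bv j))))).subset ?_
    rintro q ⟨t, β, h, h0, hω, rfl⟩
    rcases (h.act (cs.wordProd ω)).dich with hp | hn
    · right
      rw [cs.wordProd_cons, rep_mul, rep_simple] at hω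
      have h3 := flip_simple hp hω
      set c := (rep cs hA (cs.wordProd ω) β) j
      have hc : c ≠ 0 := by
        intro hc
        rw [hc, zero_smul] at h3
        exact (h.act (cs.wordProd ω)).ne_zero h3
      have h4 : β = c • rep cs hA (cs.wordProd ω)⁻¹ (bv j) := by
        rw [← map_smul, ← h3, rep_inv_cancel]
      rw [Set.mem_singleton_iff, h4, hφ _ _ hc]
    · left
      exact ⟨t, β, h, h0, hn, rfl⟩

/-- Descent step in a rank two subsystem with extremal roots `β₁`, `β₂`. -/
lemma descent_step {hA : Good M A} {t t₁ t₂ : W} {β₁ β₂ : V3} {x y : ℝ}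
    (h₁ : IsRt cs hA t₁ β₁) (_h₂ : IsRt cs hA t₂ β₂) (p₁ : 0 ≤ β₁) (p₂ : 0 ≤ β₂)
    (H : ∀ (t' : W) (x y : ℝ), IsRt cs hA t' (x • β₁ + y • β₂) → (0 ≤ x ∧ 0 ≤ y) ∨ (x ≤ 0 ∧ y ≤ 0))
    (h : IsRt cs hA t (x • β₁ + y • β₂)) (hy : 0 < y)
    {f : V3 →ₗ[ℝ] ℝ} (hf : ∀ z, rep cs hA t z = z - f z • (x • β₁ + y • β₂))
    (hk : 0 < f β₁) :
    cs.length (t₁ * t * t₁) < cs.length t := by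
  have e1 : rep cs hA t β₁ = (1 - f β₁ * x) • β₁ + (-(f β₁ * y)) • β₂ := by
    rw [hf]; module
  have r1 := h₁.act t
  rw [e1] at r1
  have s1 : (1 - f β₁ * x) ≤ 0 := by
    rcases H _ _ _ r1 with h | h
    · have := mul_pos hk hy; linarith [h.2]
    · exact h.1
  have neg1 : rep cs hA t β₁ ≤ 0 := by
    rw [e1]
    have hp : f β₁ * y ≥ 0 := (mul_pos hk hy).le
    exact add_nonpos (smul_nonpos_of_nonpos_of_nonneg s1 p₁)
      (smul_nonpos_of_nonpos_of_nonneg (by linarith) p₂)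
  have l1 := h₁.exchange p₁ neg1
  obtain ⟨f₁, hf₁, hr₁⟩ := h₁.refl
  have r2 := h.act t₁
  have e2 : rep cs hA t₁ (x • β₁ + y • β₂) =
      (x - f₁ (x • β₁ + y • β₂)) • β₁ + y • β₂ := by
    rw [hr₁]; module
  rw [e2] at r2
  have s2 : 0 ≤ x - f₁ (x • β₁ + y • β₂) := by
    rcases H _ _ _ r2 with h | h
    · exact h.1
    · linarith [h.2]
  have e3 : rep cs hA (t₁ * t) β₁ = - β₁ - f β₁ • rep cs hA t₁ (x • β₁ + y • β₂) := by
    rw [rep_mul, hf, map_sub, map_smul, hr₁ β₁, hf₁]; module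
  have neg2 : rep cs hA (t₁ * t) β₁ ≤ 0 := by
    rw [e3, e2]
    have : 0 ≤ f β₁ • ((x - f₁ (x • β₁ + y • β₂)) • β₁ + y • β₂) :=
      smul_nonneg hk.le (add_nonneg (smul_nonneg s2 p₁) (smul_nonneg hy.le p₂))
    have h3 : 0 ≤ β₁ + f β₁ • ((x - f₁ (x • β₁ + y • β₂)) • β₁ + y • β₂) := add_nonneg p₁ this
    rw [← neg_nonneg]
    convert h3 using 1
    module
  have l2 := h₁.exchange p₁ neg2
  have l3 : cs.length (t₁ * t) = cs.length (t * t₁) := by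
    rw [← cs.length_inv, mul_inv_rev, h.inv_eq, h₁.inv_eq]
  omega


lemma extremal_aux {hA : Good M A} {s k : Fin 3} {t₀ : W} {β₀ : V3} (h₀ : IsRt cs hA t₀ β₀)
    (p₀ : 0 ≤ β₀) (hks : k ≠ s) (hk : 0 < β₀ k) {f₀ : V3 →ₗ[ℝ] ℝ} (hf2 : f₀ β₀ = 2)
    (hr : ∀ z, rep cs hA t₀ z = z - f₀ z • β₀) (hf : f₀ (bv s) ≤ 0) :
    ∃ (t : W) (δ : V3) (x₀ y₀ : ℝ), 0 < y₀ ∧ IsRt cs hA t δ ∧ 0 ≤ δ ∧ δ = x₀ • bv s + y₀ • β₀ ∧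
      ∀ (t' : W) (x y : ℝ), IsRt cs hA t' (x • bv s + y • δ) →
        (0 ≤ x ∧ 0 ≤ y) ∨ (x ≤ 0 ∧ y ≤ 0) := by
  have bs : bv s s = 1 := by simp [bv]
  have bk : bv s k = 0 := by simp [bv, hks]
  set φ : V3 → ℝ := fun v => v s / v k with hφ
  set S : Set ℝ := {q | ∃ t β, IsRt cs hA t β ∧ 0 ≤ β ∧ rep cs hA t₀ β ≤ 0 ∧
    (∃ x y : ℝ, β = x • bv s + y • β₀) ∧ φ β = q} with hS
  have hfin : S.Finite := by
    refine (finite_inv (cs := cs) hA φ ?_ t₀).subset ?_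
    · intro c v hc
      simp only [hφ, Pi.smul_apply, smul_eq_mul]
      exact mul_div_mul_left _ _ hc
    · rintro q ⟨t, β, a, b, c, -, e⟩
      exact ⟨t, β, a, b, c, e⟩
  have h0S : φ β₀ ∈ S := by
    refine ⟨t₀, β₀, h₀, p₀, ?_, ⟨0, 1, by module⟩, rfl⟩
    rw [hr, hf2]
    have : β₀ - (2 : ℝ) • β₀ = -β₀ := by module
    rw [this]; exact neg_nonpos.2 p₀
  obtain ⟨q, ⟨t, δ, hδ, pδ, nδ, ⟨x₀, y₀, eδ⟩, eφ⟩, hmin⟩ := hfin.exists_minimal ⟨_, h0S⟩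
  have hmin' : ∀ q' ∈ S, q ≤ q' := by
    intro q' hq'
    rcases le_total q q' with h | h
    · exact h
    · exact hmin hq' h
  have δs : δ s = x₀ + y₀ * β₀ s := by rw [eδ]; simp [bs]
  have δk : δ k = y₀ * β₀ k := by rw [eδ]; simp [bk]
  have b0s : 0 ≤ β₀ s := p₀ s
  have hy0 : 0 ≤ y₀ := by
    have : 0 ≤ δ k := pδ k
    rw [δk] at this
    exact nonneg_of_mul_nonneg_left this hk
  have hy : 0 < y₀ := by
    rcases hy0.lt_or_eq with h | h
    · exact h
    exfalso
    have hx0 : 0 ≤ x₀ := by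
      have : 0 ≤ δ s := pδ s
      rw [δs, ← h] at this; linarith
    have hx : 0 < x₀ := by
      rcases hx0.lt_or_eq with h' | h'
      · exact h'
      · exact absurd (by rw [eδ, ← h, ← h']; module) hδ.ne_zero
    have n := nδ s
    rw [hr, eδ, ← h] at n
    simp [bs] at n
    have : x₀ * f₀ (bv s) * β₀ s ≤ 0 :=
      mul_nonpos_of_nonpos_of_nonneg (mul_nonpos_of_nonneg_of_nonpos hx0 hf) b0s
    linarith
  have key : ∀ (t' : W) (x y : ℝ), IsRt cs hA t' (x • bv s + y • δ) → 0 ≤ x • bv s + y • δ →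
      0 ≤ x ∧ 0 ≤ y := by
    intro t' x y h p
    have gs : (x • bv s + y • δ) s = x + y * δ s := by simp [bs]
    have gk : (x • bv s + y • δ) k = y * δ k := by simp [bk]
    have δkpos : 0 < δ k := by rw [δk]; positivity
    have hy' : 0 ≤ y := by
      have : 0 ≤ (x • bv s + y • δ) k := p k
      rw [gk] at this
      exact nonneg_of_mul_nonneg_left this δkpos
    refine ⟨?_, hy'⟩
    rcases hy'.lt_or_eq with hyp | hye
    swap
    · have : 0 ≤ (x • bv s + y • δ) s := p s
      rw [gs, ← hye] at this; linarith
    by_contra hx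
    push Not at hx
    rcases le_or_gt 0 (x + y * x₀) with hX | hX
    · have := hmin' _ h0S
      rw [← eφ] at this
      simp only [hφ] at this
      rw [div_le_div_iff₀ δkpos hk, δs, δk] at this
      have h3 : x₀ * β₀ k ≤ 0 := by nlinarith
      have h4 : x₀ ≤ 0 := by
        by_contra h5
        push Not at h5
        have := mul_pos h5 hk
        linarith
      have : y * x₀ ≤ 0 := mul_nonpos_of_nonneg_of_nonpos hy' h4
      linarith
    · have : φ (x • bv s + y • δ) ∈ S := by
        refine ⟨t', _, h, p, ?_, ⟨x + y * x₀, y * y₀, by rw [eδ]; module⟩, rfl⟩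
        have r := h.act t₀
        rcases r.dich with r | r
        · exfalso
          have r1 := r s
          have r2 := r k
          rw [hr] at r1 r2
          have e : f₀ (x • bv s + y • δ) = (x + y * x₀) * f₀ (bv s) + 2 * (y * y₀) := by
            rw [eδ]; simp [hf2]; ring
          rw [e] at r2
          simp [bk] at r2
          rw [δk] at r2
          have a1 : 0 ≤ (x + y * x₀) * f₀ (bv s) := mul_nonneg_of_nonpos_of_nonpos hX.le hf
          have a2 := mul_nonneg a1 hk.le
          have a3 : 0 < y * y₀ * β₀ k := by positivity
          nlinarith
        · exact r
      have := hmin' _ this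
      rw [← eφ] at this
      simp only [hφ] at this
      rw [gs, gk, div_le_div_iff₀ δkpos (mul_pos hyp δkpos)] at this
      have := mul_neg_of_neg_of_pos hx δkpos
      nlinarith
  refine ⟨t, δ, x₀, y₀, hy, hδ, pδ, eδ, ?_⟩
  intro t' x y h
  rcases h.dich with p | p
  · exact Or.inl (key t' x y h p)
  · right
    have e : -(x • bv s + y • δ) = (-x) • bv s + (-y) • δ := by module
    have h' := h.neg
    have p' : 0 ≤ -(x • bv s + y • δ) := neg_nonneg.2 p
    rw [e] at h' p'
    have := key t' _ _ h' p'
    constructor <;> linarith [this.1, this.2]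

lemma extremal {hA : Good M A} {s : Fin 3} {t₀ : W} {η : V3} (h₀ : IsRt cs hA t₀ η)
    (hnp : ∀ c : ℝ, η ≠ c • bv s) :
    ∃ (t : W) (δ : V3) (a b : ℝ), IsRt cs hA t δ ∧ 0 ≤ δ ∧ η = a • bv s + b • δ ∧
      ∀ (t' : W) (x y : ℝ), IsRt cs hA t' (x • bv s + y • δ) →
        (0 ≤ x ∧ 0 ≤ y) ∨ (x ≤ 0 ∧ y ≤ 0) := by
  wlog p : 0 ≤ η with W0
  · have p' : η ≤ 0 := h₀.dich.resolve_left p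
    obtain ⟨t, δ, a, b, h1, h2, h3, h4⟩ := W0 h₀.neg
      (fun c hc => hnp (-c) (by rw [neg_smul, ← hc, neg_neg])) (neg_nonneg.2 p')
    refine ⟨t, δ, -a, -b, h1, h2, ?_, h4⟩
    rw [← neg_neg η, h3]; module
  have hk : ∃ k, k ≠ s ∧ 0 < η k := by
    by_contra hcon
    push Not at hcon
    apply hnp (η s)
    ext k
    by_cases hks : k = s
    · subst hks; simp [bv]
    · have := le_antisymm (hcon k hks) (p k)
      rw [this]; simp [bv, hks]
  obtain ⟨k, hks, hk⟩ := hk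
  obtain ⟨f, hf2, hr⟩ := h₀.refl
  rcases le_or_gt (f (bv s)) 0 with hf | hf
  · obtain ⟨t, δ, x₀, y₀, hy, h1, h2, h3, h4⟩ := extremal_aux h₀ p hks hk hf2 hr hf
    refine ⟨t, δ, -(x₀ / y₀), 1 / y₀, h1, h2, ?_, h4⟩
    rw [h3]
    have : y₀ ≠ 0 := hy.ne'
    match_scalars <;> field_simp
    ring
  · have r := h₀.act (cs.simple s)
    rw [rep_simple] at r
    have hp : 0 ≤ sig A s η := by
      rcases r.dich with q | q
      · exact q
      · exact absurd (flip_simple p q) (hnp _)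
    have ss : ∀ z, sig A s (sig A s z) = z := fun z => by
      have := congrArg (fun g => g z) (sig_sq hA s)
      simpa using this
    have q1 : 0 < sig A s η k := by rw [sig_apply]; simpa [bv, hks] using hk
    have q2 : (f.comp (sig A s)) (sig A s η) = 2 := by rw [LinearMap.comp_apply, ss, hf2]
    have q3 : ∀ z, rep cs hA (cs.simple s * t₀ * (cs.simple s)⁻¹) z =
        z - (f.comp (sig A s)) z • sig A s η := by
      intro z
      rw [cs.inv_simple, rep_mul, rep_mul, rep_simple, hr, map_sub, map_smul, ss]
      rfl
    have q4 : (f.comp (sig A s)) (bv s) ≤ 0 := by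
      rw [LinearMap.comp_apply, sig_bv_self hA, map_neg]; linarith
    obtain ⟨t, δ, x₀, y₀, hy, h1, h2, h3, h4⟩ := extremal_aux r hp hks q1 q2 q3 q4
    refine ⟨t, δ, cor A s η -(x₀ / y₀), 1 / y₀, h1, h2, ?_, h4⟩
    rw [h3, sig_apply]
    have : y₀ ≠ 0 := hy.ne'
    match_scalars <;> field_simp
    ring

variable {B : Matrix (Fin 3) (Fin 3) ℝ}

/-- A reflection with corresponding roots in both realizations. -/
def IsRt2 (cs : CoxeterSystem M W) (hA : Good M A) (hB : Good M B) (t : W) (β β' : V3) : Prop :=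
  ∃ u i, t = u * cs.simple i * u⁻¹ ∧ β = rep cs hA u (bv i) ∧ β' = rep cs hB u (bv i)

variable {hA : Good M A} {hB : Good M B} {t t₁ t₂ : W} {β β' η η' δ δ' : V3}

lemma IsRt2.left (h : IsRt2 cs hA hB t β β') : IsRt cs hA t β := by
  obtain ⟨u, i, a, b, c⟩ := h
  exact ⟨u, i, a, b⟩

lemma IsRt2.right (h : IsRt2 cs hA hB t β β') : IsRt cs hB t β' := by
  obtain ⟨u, i, a, b, c⟩ := h
  exact ⟨u, i, a, c⟩

lemma IsRt2.simple (hA : Good M A) (hB : Good M B) (i : Fin 3) :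
    IsRt2 cs hA hB (cs.simple i) (bv i) (bv i) :=
  ⟨1, i, by simp, by rw [rep_one], by rw [rep_one]⟩

lemma IsRt2.neg (h : IsRt2 cs hA hB t β β') : IsRt2 cs hA hB t (-β) (-β') := by
  obtain ⟨u, i, rfl, rfl, rfl⟩ := h
  refine ⟨u * cs.simple i, i, ?_, ?_, ?_⟩
  · simp [mul_assoc]
  · rw [rep_mul, rep_simple, sig_bv_self hA, map_neg]
  · rw [rep_mul, rep_simple, sig_bv_self hB, map_neg]

lemma IsRt2.act (h : IsRt2 cs hA hB t β β') (w : W) :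
    IsRt2 cs hA hB (w * t * w⁻¹) (rep cs hA w β) (rep cs hB w β') := by
  obtain ⟨u, i, rfl, rfl, rfl⟩ := h
  exact ⟨w * u, i, by group, by rw [rep_mul], by rw [rep_mul]⟩

lemma IsRt2.parallel (h : IsRt2 cs hA hB t β β') (h₂ : IsRt2 cs hA hB t₂ η η') {c : ℝ}
    (hc : β = c • η) : ∃ c' : ℝ, β' = c' • η' := by
  have e := h.left.uniq h₂.left hc
  subst e
  obtain ⟨f, hf, hr⟩ := h.right.refl
  obtain ⟨g, hg, hr'⟩ := h₂.right.refl
  refine ⟨g β' / 2, ?_⟩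
  have e1 := hr β'
  rw [hr' β', hf] at e1
  have e2 : g β' • η' = (2 : ℝ) • β' := sub_right_injective e1
  rw [div_eq_inv_mul, mul_smul, e2]
  module

lemma descend {s : Fin 3} (hδ : IsRt2 cs hA hB t₂ δ δ') (pδ : 0 ≤ δ)
    (H : ∀ (t' : W) (x y : ℝ), IsRt cs hA t' (x • bv s + y • δ) →
        (0 ≤ x ∧ 0 ≤ y) ∨ (x ≤ 0 ∧ y ≤ 0)) (n : ℕ) :
    ∀ (t : W) (β β' : V3) (x y : ℝ), cs.length t = n → IsRt2 cs hA hB t β β' →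
      β = x • bv s + y • δ → ∃ x' y' : ℝ, β' = x' • bv s + y' • δ' := by
  induction n using Nat.strong_induction_on with
  | _ n IH =>
  have main : ∀ (t : W) (β β' : V3) (x y : ℝ), cs.length t = n → IsRt2 cs hA hB t β β' →
      β = x • bv s + y • δ → 0 ≤ x → 0 ≤ y → ∃ x' y' : ℝ, β' = x' • bv s + y' • δ' := by
    intro t β β' x y hl h e hx hy
    rcases hx.eq_or_lt with hx0 | hx
    · obtain ⟨c, hc⟩ := h.parallel hδ (c := y) (by rw [e, ← hx0]; module)
      exact ⟨0, c, by rw [hc]; module⟩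
    rcases hy.eq_or_lt with hy0 | hy
    · obtain ⟨c, hc⟩ := h.parallel (IsRt2.simple hA hB s) (c := x) (by rw [e, ← hy0]; module)
      exact ⟨c, 0, by rw [hc]; module⟩
    obtain ⟨f, hf, hr⟩ := h.left.refl
    have hs := IsRt2.simple (cs := cs) hA hB s
    -- common step
    have step : ∀ (t₁ : W) (η η' : V3), IsRt2 cs hA hB t₁ η η' →
        (∃ a b : ℝ, η = a • bv s + b • δ) → (∃ a b : ℝ, η' = a • bv s + b • δ') →
        cs.length (t₁ * t * t₁) < cs.length t → ∃ x' y' : ℝ, β' = x' • bv s + y' • δ' := by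
      rintro t₁ η η' h1 ⟨a, b, e1⟩ ⟨a', b', e1'⟩ hlt
      have h3 := h.act t₁
      obtain ⟨g, hg, hr1⟩ := h1.left.refl
      obtain ⟨g', hg', hr1'⟩ := h1.right.refl
      have hl' : cs.length (t₁ * t * t₁⁻¹) < n := by rw [h1.left.inv_eq, ← hl]; exact hlt
      obtain ⟨x', y', e'⟩ := IH _ hl' _ _ _ (x - g β * a) (y - g β * b) rfl h3
        (by rw [hr1, e, e1]; module)
      have e4 : β' = rep cs hB t₁ β' + g' β' • η' := by rw [hr1']; module
      refine ⟨x' + g' β' * a', y' + g' β' * b', ?_⟩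
      refine e4.trans ?_
      rw [e']
      generalize g' β' = q
      rw [e1']
      module
    have h' := h.left
    rw [e] at h' hr hf
    have hpos : 0 < f (bv s) ∨ 0 < f δ := by
      by_contra hcon
      push Not at hcon
      rw [map_add, map_smul, map_smul, smul_eq_mul, smul_eq_mul] at hf
      nlinarith [mul_nonneg hx.le (neg_nonneg.2 hcon.1), mul_nonneg hy.le (neg_nonneg.2 hcon.2)]
    rcases hpos with hp | hp
    · exact step _ _ _ hs ⟨1, 0, by module⟩ ⟨1, 0, by module⟩
        (descent_step hs.left hδ.left (bv_nonneg s) pδ H h' hy hr hp)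
    · rw [add_comm] at h'
      simp only [add_comm (x • bv s)] at hr
      refine step _ _ _ hδ ⟨0, 1, by module⟩ ⟨0, 1, by module⟩
        (descent_step hδ.left hs.left pδ (bv_nonneg s) ?_ h' hx hr hp)
      intro t' x y h5
      rw [add_comm] at h5
      rcases H _ _ _ h5 with q | q
      · exact Or.inl q.symm
      · exact Or.inr q.symm
  intro t β β' x y hl h e
  have h' := h.left
  rw [e] at h'
  rcases H _ _ _ h' with q | q
  · exact main t β β' x y hl h e q.1 q.2
  · obtain ⟨x', y', e'⟩ := main t (-β) (-β') (-x) (-y) hl h.neg (by rw [e]; module)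
      (by linarith [q.1]) (by linarith [q.2])
    exact ⟨-x', -y', by rw [← neg_neg β', e']; module⟩

/-- The plane lemma. -/
lemma plane {s : Fin 3} (h : IsRt2 cs hA hB t η η') (hnp : ∀ c : ℝ, η ≠ c • bv s) :
    ∃ δ' : V3, ∀ (t₁ : W) (β β' : V3) (x y : ℝ), IsRt2 cs hA hB t₁ β β' →
      β = x • bv s + y • η → ∃ x' y' : ℝ, β' = x' • bv s + y' • δ' := by
  obtain ⟨t₂, δ, a, b, ⟨u, i, rfl, rfl⟩, p, e, H⟩ := extremal h.left hnp
  refine ⟨rep cs hB u (bv i), ?_⟩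
  intro t₁ β β' x y h1 e1
  exact descend ⟨u, i, rfl, rfl, rfl⟩ p H _ t₁ β β' (x + y * a) (y * b) rfl h1
    (by rw [e1, e]; module)

lemma detCols_eq_zero_iff (γ : Fin 3 → V3) : detCols γ = 0 ↔
    ∃ x y z : ℝ, (x ≠ 0 ∨ y ≠ 0 ∨ z ≠ 0) ∧ x • γ 0 + y • γ 1 + z • γ 2 = 0 := by
  unfold detCols
  rw [← Matrix.exists_mulVec_eq_zero_iff]
  have hmv : ∀ v : V3, Matrix.mulVec (Matrix.of fun i l => γ l i) v =
      v 0 • γ 0 + v 1 • γ 1 + v 2 • γ 2 := by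
    intro v
    ext k
    simp [Matrix.mulVec, dotProduct, Fin.sum_univ_three]
    ring
  constructor
  · rintro ⟨v, hv, h⟩
    rw [hmv] at h
    refine ⟨v 0, v 1, v 2, ?_, h⟩
    by_contra hcon
    push Not at hcon
    apply hv
    ext k
    fin_cases k
    · exact hcon.1
    · exact hcon.2.1
    · exact hcon.2.2
  · rintro ⟨x, y, z, hne, h⟩
    refine ⟨![x, y, z], ?_, ?_⟩
    · intro h0
      have h1 := congrFun h0 0
      have h2 := congrFun h0 1
      have h3 := congrFun h0 2
      simp at h1 h2 h3
      tauto
    · rw [hmv]; simpa using h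

lemma dep_core {s : Fin 3} (h₁ : IsRt2 cs hA hB t₁ β β') (h₂ : IsRt2 cs hA hB t₂ η η')
    {x y z : ℝ} (hne : x ≠ 0 ∨ y ≠ 0 ∨ z ≠ 0) (he : x • bv s + y • β + z • η = 0) :
    ∃ x y z : ℝ, (x ≠ 0 ∨ y ≠ 0 ∨ z ≠ 0) ∧ x • bv s + y • β' + z • η' = 0 := by
  by_cases hpar : ∃ c : ℝ, β = c • bv s
  · obtain ⟨c, hc⟩ := hpar
    obtain ⟨c', hc'⟩ := h₁.parallel (IsRt2.simple hA hB s) hc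
    exact ⟨-c', 1, 0, by simp, by rw [hc']; module⟩
  push Not at hpar
  have hz : z ≠ 0 := by
    intro hz
    subst hz
    have hy : y = 0 := by
      by_contra hy
      apply hpar (-(x / y))
      have : y • β = -x • bv s := by
        rw [zero_smul, add_zero] at he
        rw [eq_neg_of_add_eq_zero_right he]; module
      have e2 : β = y⁻¹ • (y • β) := by rw [smul_smul, inv_mul_cancel₀ hy, one_smul]
      rw [e2, this, smul_smul]; congr 1; field_simp
    subst hy
    have hx : x • bv s = 0 := by simpa using he
    rcases smul_eq_zero.1 hx with h | h
    · subst h; simp at hne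
    · exact bv_ne_zero s h
  obtain ⟨δ', hδ'⟩ := plane h₁ hpar
  obtain ⟨p, q, e1⟩ := hδ' _ _ _ 0 1 h₁ (by module)
  obtain ⟨p', q', e2⟩ := hδ' _ _ _ (-(x / z)) (-(y / z)) h₂ (by
    have : z • η = -(x • bv s + y • β) := eq_neg_of_add_eq_zero_right he
    have e2 : η = z⁻¹ • (z • η) := by rw [smul_smul, inv_mul_cancel₀ hz, one_smul]
    rw [e2, this]
    match_scalars <;> field_simp)
  by_cases hq : q = 0
  · exact ⟨-p, 1, 0, by simp, by rw [e1, hq]; module⟩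
  · exact ⟨-(q' * p - q * p'), q', -q, by right; right; simpa using hq, by rw [e1, e2]; module⟩

theorem det_zero (cs : CoxeterSystem M W) (hA : Good M A) (hB : Good M B) (u : Fin 3 → W)
    (i : Fin 3 → Fin 3)
    (h : detCols (fun l => rep cs hA (u l) (bv (i l))) = 0) :
    detCols (fun l => rep cs hB (u l) (bv (i l))) = 0 := by
  rw [detCols_eq_zero_iff] at h ⊢
  obtain ⟨x, y, z, hne, he⟩ := h
  have rt : ∀ l, IsRt2 cs hA hB _ (rep cs hA (u l) (bv (i l))) (rep cs hB (u l) (bv (i l))) :=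
    fun l => ⟨u l, i l, rfl, rfl, rfl⟩
  have he' := congrArg (rep cs hA (u 0)⁻¹) he
  simp only [map_add, map_smul, map_zero, rep_inv_cancel] at he'
  obtain ⟨x', y', z', hne', h'⟩ := dep_core ((rt 1).act (u 0)⁻¹) ((rt 2).act (u 0)⁻¹) hne he'
  refine ⟨x', y', z', hne', ?_⟩
  have := congrArg (rep cs hB (u 0)) h'
  simpa only [map_add, map_smul, map_zero, rep_cancel_inv] using this

/-- The Coxeter matrix with `0` in place of infinity. -/
def cox (M : Fin 3 → Fin 3 → ℕ∞) (hdiag : ∀ i, M i i = 1) (hsymm : ∀ i j, M i j = M j i)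
    (h2 : ∀ i j, i ≠ j → 2 ≤ M i j) : CoxeterMatrix (Fin 3) where
  M := Matrix.of fun i j => (M i j).toNat
  isSymm := by
    ext i j
    simp [hsymm i j]
  diagonal := by intro i; simp [hdiag]
  off_diagonal := by
    intro i j hij h
    have := h2 i j hij
    simp only [Matrix.of_apply] at h
    cases hM : M i j with
    | top => rw [hM] at h; simp at h
    | coe m =>
      rw [hM] at h this
      simp at h
      subst h
      exact absurd this (by decide)

lemma good_of_ngcm (M : Fin 3 → Fin 3 → ℕ∞) (hdiag : ∀ i, M i i = 1)
    (hsymm : ∀ i j, M i j = M j i) (h2 : ∀ i j, i ≠ j → 2 ≤ M i j)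
    (A : Matrix (Fin 3) (Fin 3) ℝ) (hA : IsNGCM M A) : Good (cox M hdiag hsymm h2) A := by
  obtain ⟨hd, hn, hz, hm, ht⟩ := hA
  refine ⟨hd, ?_⟩
  intro i j hij
  have hcox : cox M hdiag hsymm h2 i j = (M i j).toNat := rfl
  rw [hcox]
  have key : ∀ c : ℝ, 0 < c → A i j * A j i = c ^ 2 → ∃ r : ℝ, 0 < r ∧ A i j = -(r * c) ∧
      A j i = -(c / r) := by
    intro c hc e
    have hne : A i j ≠ 0 := by
      intro h0
      rw [h0, zero_mul] at e
      have : 0 < c ^ 2 := by positivity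
      linarith
    have hneg : A i j < 0 := lt_of_le_of_ne (hn i j hij) hne
    refine ⟨-A i j / c, div_pos (by linarith) hc, ?_, ?_⟩
    · field_simp
    · field_simp
      linarith
  cases hM : M i j with
  | top =>
    have h4 := ht i j hij hM
    have hs : 2 ≤ Real.sqrt (A i j * A j i) := Real.le_sqrt_of_sq_le (by linarith)
    obtain ⟨r, hr, e1, e2⟩ := key (Real.sqrt (A i j * A j i)) (by linarith)
      (Real.sq_sqrt (by linarith)).symm
    exact ⟨r, _, hr, e1, e2, Or.inr ⟨by simp, hs⟩⟩
  | coe m =>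
    have hm2 : 2 ≤ m := by have := h2 i j hij; rw [hM] at this; exact_mod_cast this
    have hp := hm i j hij m hM
    rcases hm2.eq_or_lt with h | h
    · subst h
      have z1 := (hz i j hij).2 hM
      have z2 := (hz j i hij.symm).2 (by rw [hsymm, hM]; rfl)
      refine ⟨1, 0, one_pos, by simp [z1], by simp [z2], Or.inl ⟨by simp, by simp⟩⟩
    · have hc : 0 < Real.cos (Real.pi / m) := by
        have h3 : (2 : ℝ) < m := by exact_mod_cast h
        have hm0 : (0 : ℝ) < m := by linarith
        apply Real.cos_pos_of_mem_Ioo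
        constructor
        · have : 0 < Real.pi / m := div_pos Real.pi_pos hm0
          linarith [Real.pi_pos]
        · exact div_lt_div_of_pos_left Real.pi_pos (by norm_num) h3
      obtain ⟨r, hr, e1, e2⟩ := key (2 * Real.cos (Real.pi / m)) (by linarith)
        (by rw [hp]; ring)
      refine ⟨r, _, hr, e1, e2, Or.inl ⟨?_, by simp⟩⟩
      simp; omega

lemma rho_eq (cs : CoxeterSystem M W) (hA : Good M A) (w : List (Fin 3)) (x : V3) :
    rhoA A w x = rep cs hA (cs.wordProd w) x := by
  induction w with
  | nil => rw [cs.wordProd_nil, rep_one]; rfl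
  | cons j w ih =>
    rw [cs.wordProd_cons, rep_mul, rep_simple, ← ih, sig_apply, cor_apply]
    rfl

/-- Log-linear path between two matrices. -/
noncomputable def pth (A B : Matrix (Fin 3) (Fin 3) ℝ) (τ : ℝ) : Matrix (Fin 3) (Fin 3) ℝ :=
  Matrix.of fun i j => if i = j then 2 else if A i j = 0 then 0 else
    -Real.exp ((1 - τ) * Real.log (-A i j) + τ * Real.log (-B i j))

lemma pth_ngcm {M : Fin 3 → Fin 3 → ℕ∞} {A B : Matrix (Fin 3) (Fin 3) ℝ}
    (hsymm : ∀ i j, M i j = M j i)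
    (hA : IsNGCM M A) (hB : IsNGCM M B) {τ : ℝ} (h0 : 0 ≤ τ) (h1 : τ ≤ 1) :
    IsNGCM M (pth A B τ) := by
  obtain ⟨ad, an, az, am, at'⟩ := hA
  obtain ⟨bd, bn, bz, bm, bt⟩ := hB
  have hoff : ∀ i j, i ≠ j → M i j ≠ 2 → pth A B τ i j =
      -Real.exp ((1 - τ) * Real.log (-A i j) + τ * Real.log (-B i j)) := by
    intro i j hij hM
    have : A i j ≠ 0 := fun h => hM ((az i j hij).1 h)
    simp [pth, hij, this]
  have hoff0 : ∀ i j, i ≠ j → M i j = 2 → pth A B τ i j = 0 := by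
    intro i j hij hM
    simp [pth, hij, (az i j hij).2 hM]
  have hprod : ∀ i j, i ≠ j → M i j ≠ 2 → 0 < A i j * A j i ∧ 0 < B i j * B j i ∧
      pth A B τ i j * pth A B τ j i =
      Real.exp ((1 - τ) * Real.log (A i j * A j i) + τ * Real.log (B i j * B j i)) := by
    intro i j hij hM
    have hM' : M j i ≠ 2 := by rw [hsymm]; exact hM
    have a1 : A i j ≠ 0 := fun h => hM ((az i j hij).1 h)
    have a2 : A j i ≠ 0 := fun h => hM' ((az j i hij.symm).1 h)
    have b1 : B i j ≠ 0 := fun h => hM ((bz i j hij).1 h)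
    have b2 : B j i ≠ 0 := fun h => hM' ((bz j i hij.symm).1 h)
    refine ⟨mul_pos_of_neg_of_neg (lt_of_le_of_ne (an i j hij) a1)
      (lt_of_le_of_ne (an j i hij.symm) a2), mul_pos_of_neg_of_neg
      (lt_of_le_of_ne (bn i j hij) b1) (lt_of_le_of_ne (bn j i hij.symm) b2), ?_⟩
    rw [hoff i j hij hM, hoff j i hij.symm hM', neg_mul_neg, ← Real.exp_add,
      Real.log_mul a1 a2, Real.log_mul b1 b2]
    simp only [Real.log_neg_eq_log]
    congr 1
    ring
  refine ⟨?_, ?_, ?_, ?_, ?_⟩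
  · intro i; simp [pth]
  · intro i j hij
    by_cases hM : M i j = 2
    · rw [hoff0 i j hij hM]
    · rw [hoff i j hij hM]; linarith [Real.exp_pos ((1 - τ) * Real.log (-A i j) + τ * Real.log (-B i j))]
  · intro i j hij
    by_cases hM : M i j = 2
    · simp [hoff0 i j hij hM, hM]
    · rw [hoff i j hij hM]
      simp [hM, Real.exp_ne_zero]
  · intro i j hij m hm
    by_cases hM : M i j = 2
    · have : m = 2 := by rw [hm] at hM; exact_mod_cast hM
      rw [hoff0 i j hij hM, this]; simp
    · obtain ⟨pa, pb, e⟩ := hprod i j hij hM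
      have ea := am i j hij m hm
      have eb := bm i j hij m hm
      rw [e, eb, ← ea, ← add_mul, sub_add_cancel, one_mul, Real.exp_log pa]
  · intro i j hij hm
    have hM : M i j ≠ 2 := by rw [hm]; decide
    obtain ⟨pa, pb, e⟩ := hprod i j hij hM
    have ea := Real.log_le_log (by norm_num) (at' i j hij hm)
    have eb := Real.log_le_log (by norm_num) (bt i j hij hm)
    rw [e, ← Real.log_le_iff_le_exp (by norm_num)]
    nlinarith

lemma pth_zero {M : Fin 3 → Fin 3 → ℕ∞} {A B : Matrix (Fin 3) (Fin 3) ℝ} (hA : IsNGCM M A) :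
    pth A B 0 = A := by
  ext i j
  by_cases hij : i = j
  · subst hij; simp [pth, hA.1]
  by_cases h : A i j = 0
  · simp [pth, hij, h]
  · have : A i j < 0 := lt_of_le_of_ne (hA.2.1 i j hij) h
    simp only [pth, Matrix.of_apply, hij, h, if_false]
    rw [sub_zero, one_mul, zero_mul, add_zero, Real.exp_log (by linarith), neg_neg]

lemma pth_one {M : Fin 3 → Fin 3 → ℕ∞} {A B : Matrix (Fin 3) (Fin 3) ℝ} (hA : IsNGCM M A)
    (hB : IsNGCM M B) : pth A B 1 = B := by
  ext i j
  by_cases hij : i = j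
  · subst hij; simp [pth, hB.1]
  by_cases h : A i j = 0
  · have : B i j = 0 := (hB.2.2.1 i j hij).2 ((hA.2.2.1 i j hij).1 h)
    simp [pth, hij, h, this]
  · have hb : B i j ≠ 0 := fun h' => h ((hA.2.2.1 i j hij).2 ((hB.2.2.1 i j hij).1 h'))
    have : B i j < 0 := lt_of_le_of_ne (hB.2.1 i j hij) hb
    simp only [pth, Matrix.of_apply, hij, h, if_false]
    rw [sub_self, one_mul, zero_mul, zero_add, Real.exp_log (by linarith), neg_neg]

lemma pth_cont (A B : Matrix (Fin 3) (Fin 3) ℝ) (i j : Fin 3) :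
    Continuous fun τ => pth A B τ i j := by
  simp only [pth, Matrix.of_apply]
  split_ifs
  · fun_prop
  · fun_prop
  · fun_prop

lemma rho_cont (A B : Matrix (Fin 3) (Fin 3) ℝ) (w : List (Fin 3)) (x : V3) :
    Continuous fun τ => rhoA (pth A B τ) w x := by
  induction w with
  | nil => exact continuous_const
  | cons j w ih =>
    change Continuous fun τ => rhoA (pth A B τ) w x -
      (∑ k, pth A B τ k j * rhoA (pth A B τ) w x k) • (Pi.single j 1 : Fin 3 → ℝ)
    have hs : Continuous fun τ => ∑ k, pth A B τ k j * rhoA (pth A B τ) w x k :=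
      continuous_finsetSum _ fun k _ => (pth_cont A B k j).mul ((continuous_apply k).comp ih)
    fun_prop

lemma det_cont (A B : Matrix (Fin 3) (Fin 3) ℝ) (w : Fin 3 → List (Fin 3)) (idx : Fin 3 → Fin 3) :
    Continuous fun τ => detCols fun l => rhoA (pth A B τ) (w l) (Pi.single (idx l) 1) := by
  unfold detCols
  refine Continuous.matrix_det ?_
  refine continuous_matrix fun i l => ?_
  exact (continuous_apply i).comp (rho_cont A B (w l) _)

theorem main (M : Fin 3 → Fin 3 → ℕ∞)
    (hdiag : ∀ i, M i i = 1)
    (hsymm : ∀ i j, M i j = M j i)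
    (h2 : ∀ i j, i ≠ j → 2 ≤ M i j)
    (A B : Matrix (Fin 3) (Fin 3) ℝ) (hA : IsNGCM M A) (hB : IsNGCM M B)
    (w : Fin 3 → List (Fin 3)) (idx : Fin 3 → Fin 3) :
    Real.sign (detCols fun l => rhoA A (w l) (Pi.single (idx l) 1)) =
    Real.sign (detCols fun l => rhoA B (w l) (Pi.single (idx l) 1)) := by
  set D : ℝ → ℝ := fun τ => detCols fun l => rhoA (pth A B τ) (w l) (Pi.single (idx l) 1) with hD
  have hc : Continuous D := det_cont A B w idx
  have hDA : D 0 = detCols fun l => rhoA A (w l) (Pi.single (idx l) 1) := by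
    simp only [hD]; rw [pth_zero hA]
  have hDB : D 1 = detCols fun l => rhoA B (w l) (Pi.single (idx l) 1) := by
    simp only [hD]; rw [pth_one hA hB]
  have hz : ∀ σ τ : ℝ, 0 ≤ σ → σ ≤ 1 → 0 ≤ τ → τ ≤ 1 → D σ = 0 → D τ = 0 := by
    intro σ τ s0 s1 t0 t1 h
    have g1 := good_of_ngcm M hdiag hsymm h2 _ (pth_ngcm hsymm hA hB s0 s1)
    have g2 := good_of_ngcm M hdiag hsymm h2 _ (pth_ngcm hsymm hA hB t0 t1)
    have := det_zero (cox M hdiag hsymm h2).toCoxeterSystem g1 g2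
      (fun l => (cox M hdiag hsymm h2).toCoxeterSystem.wordProd (w l)) idx
    simp only [← rho_eq] at this
    exact this h
  rw [← hDA, ← hDB]
  have z01 := hz 0 1 le_rfl zero_le_one zero_le_one le_rfl
  have z10 := hz 1 0 zero_le_one le_rfl le_rfl zero_le_one
  rcases lt_trichotomy (D 0) 0 with ha | ha | ha
  · rcases lt_trichotomy (D 1) 0 with hb | hb | hb
    · rw [Real.sign_of_neg ha, Real.sign_of_neg hb]
    · exact absurd (z10 hb) ha.ne
    · obtain ⟨τ, ht, he⟩ := intermediate_value_Icc zero_le_one hc.continuousOn ⟨ha.le, hb.le⟩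
      exact absurd (hz τ 0 ht.1 ht.2 le_rfl zero_le_one he) ha.ne
  · rw [z01 ha, ha]
  · rcases lt_trichotomy (D 1) 0 with hb | hb | hb
    · obtain ⟨τ, ht, he⟩ := intermediate_value_Icc' zero_le_one hc.continuousOn ⟨hb.le, ha.le⟩
      exact absurd (hz τ 0 ht.1 ht.2 le_rfl zero_le_one he) ha.ne'
    · exact absurd (z10 hb) ha.ne'
    · rw [Real.sign_of_pos ha, Real.sign_of_pos hb]

end RankThree

/-- for a rank-3 Coxeter matrix `M` and any two NGCMs `A`, `B` for `M`, the
chirotopes of the corresponding realized root systems agree: for all words `w_1, w_2, w_3`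
and indices `i_1, i_2, i_3`,
`sign det(ρ_A(w_1)(e_{i_1}), ρ_A(w_2)(e_{i_2}), ρ_A(w_3)(e_{i_3}))
  = sign det(ρ_B(w_1)(e_{i_1}), ρ_B(w_2)(e_{i_2}), ρ_B(w_3)(e_{i_3}))`. -/
theorem rank_three_chirotope_indep (M : Fin 3 → Fin 3 → ℕ∞)
    (hdiag : ∀ i, M i i = 1)
    (hsymm : ∀ i j, M i j = M j i)
    (h2 : ∀ i j, i ≠ j → 2 ≤ M i j)
    (A B : Matrix (Fin 3) (Fin 3) ℝ) (hA : IsNGCM M A) (hB : IsNGCM M B)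
    (w : Fin 3 → List (Fin 3)) (idx : Fin 3 → Fin 3) :
    Real.sign (detCols fun l => rhoA A (w l) (Pi.single (idx l) 1)) =
    Real.sign (detCols fun l => rhoA B (w l) (Pi.single (idx l) 1)) := by
  exact RankThree.main M hdiag hsymm h2 A B hA hB w idx
end
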